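/- arXiv:1205.4044 — 10 statements merged into one kernel-verified Lean document; each statement's English description precedes it below -/
import Mathlib

section
/- Let θ ∈ (−π/2, π/2) with θ ≠ 0. Then there exists K_θ > 2 with the following property: (i) if 1 < K < K_θ, then H_{K,θ} has exactly one fixed angle in (−π, π], and its fixed ray is locally repelling; (ii) if K = K_θ, then H_{K,θ} has exactly two fixed angles in (−π, π], one whose ray is locally repelling and one whose ray is neutral; (iii) if K > K_θ, then H_{K,θ} has exactly three fixed angles in (−π, π], one whose ray is locally attracting and two whose rays are locally repelling. -/
open Real Complex Filter Topology

/-- The affine stretch `h_{K,θ}(z) = ((K+1)/2)z + e^{2iθ}((K−1)/2) conj z`. -/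
noncomputable def hK (K θ : ℝ) (z : ℂ) : ℂ :=
  (((K + 1) / 2 : ℝ) : ℂ) * z +
    Complex.exp (2 * (θ : ℂ) * Complex.I) * (((K - 1) / 2 : ℝ) : ℂ) * (starRingEnd ℂ) z

/-- `H_{K,θ}(z) = (h_{K,θ}(z))²`. -/
noncomputable def HK (K θ : ℝ) (z : ℂ) : ℂ := (hK K θ z) ^ 2

/-- The ray `R_φ = {t e^{iφ} : t ≥ 0}`. -/
noncomputable def Ray (φ : ℝ) : Set ℂ :=
  {w : ℂ | ∃ t : ℝ, 0 ≤ t ∧ w = (t : ℂ) * Complex.exp ((φ : ℂ) * Complex.I)}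

/-- `φ` is a fixed angle of `H_{K,θ}`: `H_{K,θ}(e^{iφ}) = t e^{iφ}` for some `t > 0`. -/
noncomputable def IsFixedAngle (K θ φ : ℝ) : Prop :=
  ∃ t : ℝ, 0 < t ∧
    HK K θ (Complex.exp ((φ : ℂ) * Complex.I)) = (t : ℂ) * Complex.exp ((φ : ℂ) * Complex.I)

/-- The fixed ray `R_φ` is locally repelling. -/
noncomputable def IsRepelling (K θ φ : ℝ) : Prop :=
  1 < 2 * K / (1 + (K ^ 2 - 1) * Real.cos (φ - θ) ^ 2)

/-- The fixed ray `R_φ` is locally attracting. -/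
noncomputable def IsAttracting (K θ φ : ℝ) : Prop :=
  2 * K / (1 + (K ^ 2 - 1) * Real.cos (φ - θ) ^ 2) < 1

/-- The fixed ray `R_φ` is neutral. -/
noncomputable def IsNeutral (K θ φ : ℝ) : Prop :=
  2 * K / (1 + (K ^ 2 - 1) * Real.cos (φ - θ) ^ 2) = 1

/-- The cubic whose real roots `t = tan (φ / 2 - θ)`, for `m = tan θ`, are the fixed rays. -/
noncomputable def rayCubic (K m t : ℝ) : ℝ :=
  K * t ^ 3 + (2 * K - 1) * m * t ^ 2 + (2 - K) * t + m

theorem rayCubic_neg (K m t : ℝ) : rayCubic K (-m) (-t) = -rayCubic K m t := by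
  unfold rayCubic; ring

theorem continuous_rayCubic (K m : ℝ) : Continuous (rayCubic K m) := by
  unfold rayCubic; fun_prop

/-- A negative root lies in the repelling range. -/
theorem rayCubic_root_neg_bound {K m t : ℝ} (hK : 1 < K) (hm : 0 < m) (ht : t < 0)
    (h : rayCubic K m t = 0) : K - 2 < K * t ^ 2 := by
  unfold rayCubic at h
  have hD : 0 < m * ((2 * K - 1) * t ^ 2 + 1) :=
    mul_pos hm (by nlinarith [sq_nonneg t])
  by_contra! hle
  nlinarith [mul_nonneg (neg_nonneg.2 ht.le) (sub_nonneg.2 hle)]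

theorem rayCubic_root_pos_bound {K m t : ℝ} (hK : 1 < K) (hm : 0 < m) (ht : 0 < t)
    (h : rayCubic K m t = 0) : K * t ^ 2 < K - 2 := by
  unfold rayCubic at h
  have hD : 0 < m * ((2 * K - 1) * t ^ 2 + 1) :=
    mul_pos hm (by nlinarith [sq_nonneg t])
  by_contra! hle
  nlinarith [mul_nonneg ht.le (sub_nonneg.2 hle)]

theorem rayCubic_root_ne_zero {K m t : ℝ} (hm : 0 < m) (h : rayCubic K m t = 0) : t ≠ 0 := by
  rintro rfl
  simp [rayCubic] at h
  exact hm.ne' h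

theorem repelling_of_bound {K t : ℝ} (hK : 1 < K) (ht : t ≠ 0) (h : K - 2 < K * t ^ 2) :
    K - 2 < (2 * K - 1) * K * t ^ 2 := by
  have : 0 < t ^ 2 := by positivity
  nlinarith [mul_pos (mul_pos (by linarith : (0:ℝ) < K) this) (by linarith : (0:ℝ) < K - 1)]

theorem exists_neg_root_rayCubic {K m : ℝ} (hK : 1 < K) (hm : 0 < m) :
    ∃ t < 0, rayCubic K m t = 0 := by
  have h0 : 0 < rayCubic K m 0 := by simpa [rayCubic] using hm
  have h1 : rayCubic K m (-(1 + 3 * m)) < 0 := by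
    unfold rayCubic
    nlinarith [mul_pos hm hm, mul_pos (mul_pos hm hm) hm, mul_pos (mul_pos hm hm) (sub_pos.2 hK),
      mul_pos (mul_pos (mul_pos hm hm) hm) (sub_pos.2 hK), mul_pos hm (sub_pos.2 hK)]
  obtain ⟨t, ht, hr⟩ := intermediate_value_Ioo (by linarith : -(1 + 3 * m) ≤ 0)
    (continuous_rayCubic K m).continuousOn ⟨h1, h0⟩
  exact ⟨t, ht.2, hr⟩

theorem rayCubic_neg_root_unique {K m s t : ℝ} (hK : 1 < K) (hm : 0 < m) (hs : s < 0) (ht : t < 0)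
    (hrs : rayCubic K m s = 0) (hrt : rayCubic K m t = 0) : s = t := by
  have hbs := rayCubic_root_neg_bound hK hm hs hrs
  have hp : 0 < s * t := mul_pos_of_neg_of_neg hs ht
  have hfac : (s - t) * (K - 2 - K * (s ^ 2 + s * t + t ^ 2) - (K - 2) * (2 * K - 1) * (s * t)
      - K * (2 * K - 1) * (s * t) ^ 2) = 0 := by
    unfold rayCubic at hrs hrt
    linear_combination (-((2 * K - 1) * t ^ 2 + 1)) * hrs + ((2 * K - 1) * s ^ 2 + 1) * hrt
  rcases mul_eq_zero.1 hfac with h | h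
  · linarith
  have hpos : 0 < K * (2 * K - 1) * (s * t) ^ 2 := by
    have : 0 < 2 * K - 1 := by linarith
    positivity
  have ht2 : 0 < K * t ^ 2 := by
    have := ht.ne
    positivity
  have hmid : 0 < (K + (K - 2) * (2 * K - 1)) * (s * t) ∨ K ≤ 2 := by
    rcases le_total K 2 with h2 | h2
    · exact Or.inr h2
    · left
      have : 0 ≤ (K - 2) * (2 * K - 1) := mul_nonneg (by linarith) (by linarith)
      exact mul_pos (by linarith) hp
  rcases hmid with hmid | hmid
  · nlinarith
  · have hq : 0 < 3 * K + (K - 2) * (2 * K - 1) := by nlinarith [sq_nonneg (K - 1)]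
    nlinarith [mul_pos hq hp, mul_nonneg (by linarith : (0:ℝ) ≤ K) (sq_nonneg (s - t))]

theorem rayCubic_root_cases {K m t₀ t₁ t₂ x : ℝ} (hK : 1 < K) (h01 : t₀ ≠ t₁) (h02 : t₀ ≠ t₂)
    (h12 : t₁ ≠ t₂) (h0 : rayCubic K m t₀ = 0) (h1 : rayCubic K m t₁ = 0)
    (h2 : rayCubic K m t₂ = 0) (hx : rayCubic K m x = 0) : x = t₀ ∨ x = t₁ ∨ x = t₂ := by
  have quot : ∀ y, t₀ ≠ y → rayCubic K m y = 0 →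
      K * (y ^ 2 + y * t₀ + t₀ ^ 2) + (2 * K - 1) * m * (y + t₀) + (2 - K) = 0 := by
    intro y hy hr
    refine mul_left_cancel₀ (sub_ne_zero.2 hy) ?_
    unfold rayCubic at h0 hr
    linear_combination h0 - hr
  have quot' : ∀ y, t₀ ≠ y → t₁ ≠ y → rayCubic K m y = 0 →
      K * (y + t₁ + t₀) + (2 * K - 1) * m = 0 := by
    intro y hy hy' hr
    refine mul_left_cancel₀ (sub_ne_zero.2 hy') ?_
    linear_combination quot t₁ h01 h1 - quot y hy hr
  by_contra! hne
  refine hne.2.2 (mul_left_cancel₀ (by linarith : K ≠ 0) ?_)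
  linear_combination quot' x hne.1.symm hne.2.1.symm hx - quot' t₂ h02 h12 h2

/-- The critical abscissa: the threshold between attracting and repelling roots. -/
noncomputable def critRoot (K : ℝ) : ℝ := √((K - 2) / ((2 * K - 1) * K))

theorem critRoot_pos {K : ℝ} (hK : 2 < K) : 0 < critRoot K :=
  Real.sqrt_pos.2 (div_pos (by linarith) (mul_pos (by linarith) (by linarith)))

theorem critRoot_sq {K : ℝ} (hK : 2 < K) : (2 * K - 1) * K * critRoot K ^ 2 = K - 2 := by
  have h : 0 < (2 * K - 1) * K := mul_pos (by linarith) (by linarith)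
  rw [critRoot, Real.sq_sqrt (div_nonneg (by linarith) h.le), mul_div_cancel₀ _ h.ne']

/-- The square of the value of `tan θ` at which the critical abscissa becomes a root. -/
noncomputable def critValue (K : ℝ) : ℝ := K * ((K - 2) / (2 * K - 1)) ^ 3

theorem critValue_lt {K L : ℝ} (hK : 2 < K) (hKL : K < L) : critValue K < critValue L := by
  unfold critValue
  have h1 : 0 < (K - 2) / (2 * K - 1) := div_pos (by linarith) (by linarith)
  have h2 : (K - 2) / (2 * K - 1) < (L - 2) / (2 * L - 1) := by
    rw [div_lt_div_iff₀ (by linarith) (by linarith)]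
    nlinarith
  have : 0 < K := by linarith
  gcongr

theorem exists_critValue_eq {m : ℝ} (hm : 0 < m) : ∃ K, 2 < K ∧ critValue K = m ^ 2 := by
  have hcont : ContinuousOn critValue (Set.Icc 2 (27 * m ^ 2 + 6)) := by
    unfold critValue
    refine continuousOn_id.mul (ContinuousOn.pow (ContinuousOn.div (by fun_prop) (by fun_prop) ?_) 3)
    intro x hx
    linarith [hx.1]
  have h0 : critValue 2 < m ^ 2 := by
    have : critValue 2 = 0 := by norm_num [critValue]
    rw [this]; positivity
  have h1 : m ^ 2 < critValue (27 * m ^ 2 + 6) := by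
    have hm2 : 0 < m ^ 2 := by positivity
    have h3 : (1 / 3 : ℝ) ≤ (27 * m ^ 2 + 6 - 2) / (2 * (27 * m ^ 2 + 6) - 1) := by
      rw [div_le_div_iff₀ (by norm_num) (by linarith)]
      linarith
    unfold critValue
    calc m ^ 2 < (27 * m ^ 2 + 6) * (1 / 3) ^ 3 := by linarith
      _ ≤ _ := by gcongr
  obtain ⟨K, hK, h⟩ := intermediate_value_Ioo (by nlinarith [sq_nonneg m]) hcont ⟨h0, h1⟩
  exact ⟨K, hK.1, h⟩

/-- The critical value is `(critRoot K * K * (K - 2) / (2 * K - 1)) ^ 2`, and the value of the cubic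
at the critical abscissa compares `m` with it. -/
theorem rayCubic_critRoot {K : ℝ} (hK : 2 < K) (m : ℝ) :
    rayCubic K m (critRoot K) * (m + critRoot K * K * (K - 2) / (2 * K - 1)) =
      (2 * K - 2) / K * (m ^ 2 - critValue K) := by
  have hr := critRoot_sq hK
  have h1 : 2 * K - 1 ≠ 0 := by linarith
  have h1' : K * 2 - 1 ≠ 0 := by linarith
  have h2 : K ≠ 0 := by linarith
  have hr' : critRoot K ^ 2 = (K - 2) / ((2 * K - 1) * K) := by
    rw [eq_div_iff (mul_ne_zero h1 h2), ← hr, mul_comm]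
  have hP : rayCubic K m (critRoot K) =
      (2 * K - 2) / K * (m - critRoot K * K * (K - 2) / (2 * K - 1)) := by
    have : rayCubic K m (critRoot K) = K * critRoot K * critRoot K ^ 2 +
      (2 * K - 1) * m * critRoot K ^ 2 + (2 - K) * critRoot K + m := by unfold rayCubic; ring
    rw [this, hr']
    field_simp
    ring
  have hM : (critRoot K * K * (K - 2) / (2 * K - 1)) ^ 2 = critValue K := by
    rw [div_pow, mul_pow, mul_pow, hr', critValue]
    field_simp
  rw [hP, ← hM]
  ring

theorem rayCubic_critRoot_sign {K m : ℝ} (hK : 2 < K) (hm : 0 < m) :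
    (critValue K < m ^ 2 → 0 < rayCubic K m (critRoot K)) ∧
    (critValue K = m ^ 2 → rayCubic K m (critRoot K) = 0) ∧
    (m ^ 2 < critValue K → rayCubic K m (critRoot K) < 0) := by
  have h := rayCubic_critRoot hK m
  have hpos : 0 < m + critRoot K * K * (K - 2) / (2 * K - 1) := by
    have := critRoot_pos hK
    have : 0 < critRoot K * K * (K - 2) / (2 * K - 1) :=
      div_pos (mul_pos (mul_pos this (by linarith)) (by linarith)) (by linarith)
    linarith
  have hc : 0 < (2 * K - 2) / K := div_pos (by linarith) (by linarith)
  refine ⟨fun hlt => ?_, fun heq => ?_, fun hlt => ?_⟩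
  · exact pos_of_mul_pos_left (h ▸ mul_pos hc (sub_pos.2 hlt)) hpos.le
  · rw [heq, sub_self, mul_zero] at h
    exact (mul_eq_zero.1 h).resolve_right hpos.ne'
  · have := mul_neg_of_pos_of_neg hc (sub_neg.2 hlt)
    rw [← h] at this
    exact neg_of_mul_neg_left this hpos.le

/-- If the cubic is nonnegative at the critical abscissa, that is its only possible positive
root. -/
theorem rayCubic_pos_root_eq {K m t : ℝ} (hK : 2 < K) (ht : 0 < t)
    (hr : 0 ≤ rayCubic K m (critRoot K)) (h : rayCubic K m t = 0) :
    t = critRoot K ∧ rayCubic K m (critRoot K) = 0 := by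
  have hrp := critRoot_pos hK
  have hsq := critRoot_sq hK
  set r := critRoot K
  have key : ((2 * K - 1) * r ^ 2 + 1) * rayCubic K m t =
      ((2 * K - 1) * t ^ 2 + 1) * rayCubic K m r +
      K * (r - t) ^ 2 * ((1 + (2 * K - 1) * r ^ 2) * t + (2 * K - 2) * r) := by
    unfold rayCubic
    linear_combination (-(r - t) * (1 + r * t)) * hsq
  have hd : 0 < 2 * K - 1 := by linarith
  have hd' : 0 < 2 * K - 2 := by linarith
  have hK0 : 0 < K := by linarith
  rw [h, mul_zero] at key
  have h1 : 0 ≤ ((2 * K - 1) * t ^ 2 + 1) * rayCubic K m r := by positivity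
  have hc : 0 < (1 + (2 * K - 1) * r ^ 2) * t + (2 * K - 2) * r := by positivity
  have h2 : 0 ≤ K * (r - t) ^ 2 * ((1 + (2 * K - 1) * r ^ 2) * t + (2 * K - 2) * r) := by
    positivity
  constructor
  · have h3 : K * (r - t) ^ 2 * ((1 + (2 * K - 1) * r ^ 2) * t + (2 * K - 2) * r) = 0 := by
      linarith
    have h4 : (r - t) ^ 2 = 0 := by
      simpa [hc.ne', hK0.ne'] using h3
    linarith [pow_eq_zero_iff (two_ne_zero) |>.1 h4]
  · have h3 : ((2 * K - 1) * t ^ 2 + 1) * rayCubic K m r = 0 := by linarith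
    exact (mul_eq_zero.1 h3).resolve_left (by positivity)

theorem exists_pos_roots_rayCubic {K m : ℝ} (hK : 2 < K) (hm : 0 < m)
    (hr : rayCubic K m (critRoot K) < 0) :
    ∃ t₁ t₂, 0 < t₁ ∧ t₁ < critRoot K ∧ critRoot K < t₂ ∧
      rayCubic K m t₁ = 0 ∧ rayCubic K m t₂ = 0 := by
  have hrp := critRoot_pos hK
  have h0 : 0 < rayCubic K m 0 := by simpa [rayCubic] using hm
  have h1 : 0 < rayCubic K m (critRoot K + 1) := by
    have ht : 1 < critRoot K + 1 := by linarith
    generalize critRoot K + 1 = t at ht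
    have h3 : 0 < (2 * K - 1) * m * t ^ 2 := by
      have : 0 < 2 * K - 1 := by linarith
      positivity
    unfold rayCubic
    nlinarith [mul_pos (mul_pos (by linarith : 0 < K) (by linarith : 0 < t))
      (by nlinarith : 0 < t ^ 2 - 1)]
  obtain ⟨t₁, ht₁, hr₁⟩ := intermediate_value_Ioo' hrp.le
    (continuous_rayCubic K m).continuousOn ⟨hr, h0⟩
  obtain ⟨t₂, ht₂, hr₂⟩ := intermediate_value_Ioo (by linarith : critRoot K ≤ critRoot K + 1)
    (continuous_rayCubic K m).continuousOn ⟨hr, h1⟩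
  exact ⟨t₁, t₂, ht₁.1, ht₁.2, ht₂.1, hr₁, hr₂⟩

/-- The fixed-angle condition, as the vanishing of an imaginary part. -/
theorem isFixedAngle_iff {K : ℝ} (h1K : 1 < K) (θ φ : ℝ) :
    IsFixedAngle K θ φ ↔
      Real.sin (φ - θ) * Real.cos (φ / 2 - θ) = K * Real.cos (φ - θ) * Real.sin (φ / 2 - θ) := by
  obtain ⟨α, hα⟩ : ∃ α, α = φ - θ := ⟨_, rfl⟩
  obtain ⟨u, hu⟩ : ∃ u, u = φ / 2 - θ := ⟨_, rfl⟩
  rw [← hα, ← hu]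
  set w : ℂ := ⟨K * Real.cos α * Real.cos u + Real.sin α * Real.sin u,
    Real.sin α * Real.cos u - K * Real.cos α * Real.sin u⟩ with hw
  have hwexp : w * Complex.exp (u * I) = K * Complex.cos α + Complex.sin α * I := by
    rw [Complex.exp_mul_I]
    apply Complex.ext
    · simp [hw, Complex.cos_ofReal_re, Complex.sin_ofReal_re]
      linear_combination (K * Real.cos α) * Real.sin_sq_add_cos_sq u
    · simp [hw, Complex.cos_ofReal_re, Complex.sin_ofReal_re]
      linear_combination (Real.sin α) * Real.sin_sq_add_cos_sq u
  have hh : hK K θ (Complex.exp (φ * I)) = w * Complex.exp (φ / 2 * I) := by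
    have e1 : Complex.exp ((φ : ℂ) * I) = Complex.exp (θ * I) * Complex.exp (α * I) := by
      rw [← Complex.exp_add]; congr 1; rw [hα]; push_cast; ring
    have e2 : Complex.exp ((φ : ℂ) / 2 * I) = Complex.exp (u * I) * Complex.exp (θ * I) := by
      rw [← Complex.exp_add]; congr 1; rw [hu]; push_cast; ring
    have e3 : Complex.exp (2 * (θ : ℂ) * I) * (starRingEnd ℂ) (Complex.exp (φ * I)) =
        Complex.exp (θ * I) * Complex.exp (-α * I) := by
      rw [← Complex.exp_conj, ← Complex.exp_add, ← Complex.exp_add]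
      congr 1
      rw [hα]
      simp
      ring
    have e4 : hK K θ (Complex.exp (φ * I)) = ((K + 1) / 2 : ℝ) * Complex.exp (φ * I) +
        ((K - 1) / 2 : ℝ) *
          (Complex.exp (2 * (θ : ℂ) * I) * (starRingEnd ℂ) (Complex.exp (φ * I))) := by
      unfold hK; ring
    rw [e4, e3, e1, e2, ← mul_assoc w, hwexp, Complex.exp_mul_I α, Complex.exp_mul_I (-α),
      Complex.cos_neg, Complex.sin_neg]
    push_cast
    ring
  have hH : HK K θ (Complex.exp (φ * I)) = w ^ 2 * Complex.exp (φ * I) := by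
    rw [HK, hh, mul_pow, ← Complex.exp_nat_mul]
    congr 2
    push_cast
    ring
  have hnorm : 0 < w.re ^ 2 + w.im ^ 2 := by
    have e : w.re ^ 2 + w.im ^ 2 = K ^ 2 * Real.cos α ^ 2 + Real.sin α ^ 2 := by
      simp only [hw]
      linear_combination (K ^ 2 * Real.cos α ^ 2 + Real.sin α ^ 2) * Real.sin_sq_add_cos_sq u
    rw [e]
    nlinarith [Real.sin_sq_add_cos_sq α, mul_nonneg (by nlinarith only [h1K] : 0 ≤ K ^ 2 - 1)
      (sq_nonneg (Real.cos α))]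
  have him : Real.sin α * Real.cos u = K * Real.cos α * Real.sin u ↔ w.im = 0 := sub_eq_zero.symm
  rw [him, IsFixedAngle]
  simp only [hH, mul_left_inj' (Complex.exp_ne_zero _)]
  constructor
  · rintro ⟨t, ht, h⟩
    have hre := congrArg Complex.re h
    have him' := congrArg Complex.im h
    simp only [pow_two, Complex.mul_re, Complex.mul_im, Complex.ofReal_re, Complex.ofReal_im]
      at hre him'
    by_contra hne
    have : w.re = 0 := by
      refine mul_right_cancel₀ hne ?_
      linarith
    rw [this] at hre
    nlinarith [mul_self_nonneg w.im]
  · intro h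
    refine ⟨w.re ^ 2, by simpa [h] using hnorm, ?_⟩
    apply Complex.ext
    · simp [pow_two, h]
    · simp [pow_two, h]

/-- At a fixed angle, `tan (φ / 2 - θ)` is a root of the cubic, and conversely. -/
theorem isFixedAngle_iff_rayCubic {K θ φ : ℝ} (hK : 1 < K) (hθ : 0 < Real.cos θ) :
    IsFixedAngle K θ φ ↔ Real.cos (φ / 2 - θ) ≠ 0 ∧
      rayCubic K (Real.tan θ) (Real.tan (φ / 2 - θ)) = 0 := by
  rw [isFixedAngle_iff hK]
  have hα : φ - θ = 2 * (φ / 2 - θ) + θ := by ring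
  rw [hα]
  generalize φ / 2 - θ = u
  rw [Real.sin_add, Real.cos_add, Real.sin_two_mul, Real.cos_two_mul']
  by_cases hu : Real.cos u = 0
  · have hs : Real.sin u ≠ 0 := by
      intro h
      have := Real.sin_sq_add_cos_sq u
      rw [h, hu] at this
      norm_num at this
    have : K ≠ 0 := by linarith
    simp [hu, hs, hθ.ne', this]
  · have hne : Real.cos u ^ 3 * Real.cos θ ≠ 0 := by positivity
    have e : Real.cos u ^ 3 * Real.cos θ * rayCubic K (Real.tan θ) (Real.tan u) =
        (2 * Real.sin u * Real.cos u * Real.cos θ +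
          (Real.cos u ^ 2 - Real.sin u ^ 2) * Real.sin θ) * Real.cos u -
        K * ((Real.cos u ^ 2 - Real.sin u ^ 2) * Real.cos θ -
          2 * Real.sin u * Real.cos u * Real.sin θ) * Real.sin u := by
      rw [rayCubic, Real.tan_eq_sin_div_cos, Real.tan_eq_sin_div_cos]
      field_simp
      ring
    rw [← sub_eq_zero, ← e]
    simp [hu, hθ.ne']

/-- The derivative of the induced circle map at a fixed angle, in terms of the root. -/
theorem multiplier_eq {K θ φ : ℝ} (hK : 1 < K) (hθ : 0 < Real.cos θ) (h : IsFixedAngle K θ φ) :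
    2 * K / (1 + (K ^ 2 - 1) * Real.cos (φ - θ) ^ 2) =
      2 * (1 + K ^ 2 * Real.tan (φ / 2 - θ) ^ 2) / (K * (1 + Real.tan (φ / 2 - θ) ^ 2)) := by
  have hu := ((isFixedAngle_iff_rayCubic hK hθ).1 h).1
  have h := (isFixedAngle_iff hK θ φ).1 h
  generalize φ / 2 - θ = u at *
  generalize φ - θ = α at *
  have hs : Real.sin α = K * Real.cos α * Real.tan u := by
    rw [Real.tan_eq_sin_div_cos]
    field_simp
    linarith
  have hK0 : 0 < K := by linarith
  have hone := Real.sin_sq_add_cos_sq α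
  rw [hs] at hone
  have hc : Real.cos α ^ 2 * (1 + K ^ 2 * Real.tan u ^ 2) = 1 := by linarith
  have h1 : 0 < 1 + (K ^ 2 - 1) * Real.cos α ^ 2 := by
    have := mul_nonneg (by nlinarith : 0 ≤ K ^ 2 - 1) (sq_nonneg (Real.cos α))
    linarith
  rw [div_eq_div_iff h1.ne' (by positivity)]
  linear_combination (2 - 2 * K ^ 2) * hc

/-- The angle in `(-π, π]` with `tan (φ / 2 - θ) = t`. -/
noncomputable def angleOf (θ t : ℝ) : ℝ :=
  toIocMod Real.two_pi_pos (-π) (2 * (Real.arctan t + θ))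

theorem angleOf_mem (θ t : ℝ) : angleOf θ t ∈ Set.Ioc (-π) π := by
  have h := toIocMod_mem_Ioc Real.two_pi_pos (-π) (2 * (Real.arctan t + θ))
  rwa [show -π + 2 * π = π by ring] at h

theorem exists_angleOf_eq (θ t : ℝ) :
    ∃ n : ℤ, angleOf θ t / 2 - θ = Real.arctan t - n * π := by
  refine ⟨toIocDiv Real.two_pi_pos (-π) (2 * (Real.arctan t + θ)), ?_⟩
  rw [angleOf, toIocMod, zsmul_eq_mul]
  ring

theorem tan_angleOf (θ t : ℝ) : Real.tan (angleOf θ t / 2 - θ) = t := by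
  obtain ⟨n, hn⟩ := exists_angleOf_eq θ t
  rw [hn, Real.tan_sub_int_mul_pi, Real.tan_arctan]

theorem cos_angleOf_ne_zero (θ t : ℝ) : Real.cos (angleOf θ t / 2 - θ) ≠ 0 := by
  obtain ⟨n, hn⟩ := exists_angleOf_eq θ t
  rw [hn, Real.cos_sub_int_mul_pi]
  exact mul_ne_zero (zpow_ne_zero _ (by norm_num)) (Real.cos_arctan_pos t).ne'

theorem angleOf_tan {θ ψ : ℝ} (hψ : ψ ∈ Set.Ioc (-π) π) (hc : Real.cos (ψ / 2 - θ) ≠ 0) :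
    angleOf θ (Real.tan (ψ / 2 - θ)) = ψ := by
  have h := tan_angleOf θ (Real.tan (ψ / 2 - θ))
  have hc' := cos_angleOf_ne_zero θ (Real.tan (ψ / 2 - θ))
  have hm := angleOf_mem θ (Real.tan (ψ / 2 - θ))
  generalize angleOf θ (Real.tan (ψ / 2 - θ)) = x at *
  rw [Real.tan_eq_sin_div_cos, Real.tan_eq_sin_div_cos, div_eq_div_iff hc' hc] at h
  have hs : Real.sin ((x - ψ) / 2) = 0 := by
    rw [show (x - ψ) / 2 = (x / 2 - θ) - (ψ / 2 - θ) by ring, Real.sin_sub]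
    linarith
  have := (Real.sin_eq_zero_iff_of_lt_of_lt (by linarith [hm.1, hψ.2]) (by linarith [hm.2, hψ.1])).1
    hs
  linarith

/-- Fixed angles are parametrized by the real roots of the cubic with `m = |tan θ|`, and the
multiplier depends on the square of the root only. -/
theorem exists_fixedAngle_param {θ : ℝ} (hθ : θ ∈ Set.Ioo (-(π / 2)) (π / 2)) (hθ0 : θ ≠ 0) :
    ∃ m : ℝ, 0 < m ∧ ∃ f : ℝ → ℝ, Function.Injective f ∧ (∀ t, f t ∈ Set.Ioc (-π) π) ∧
      ∀ K : ℝ, 1 < K →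
        (∀ t, IsFixedAngle K θ (f t) ↔ rayCubic K m t = 0) ∧
        (∀ ψ ∈ Set.Ioc (-π) π, IsFixedAngle K θ ψ → ∃ t, rayCubic K m t = 0 ∧ f t = ψ) ∧
        (∀ t, rayCubic K m t = 0 → 2 * K / (1 + (K ^ 2 - 1) * Real.cos (f t - θ) ^ 2) =
          2 * (1 + K ^ 2 * t ^ 2) / (K * (1 + t ^ 2))) := by
  have hc : 0 < Real.cos θ := Real.cos_pos_of_mem_Ioo hθ
  have hinj : Function.Injective (angleOf θ) := fun s t h => by
    rw [← tan_angleOf θ s, h, tan_angleOf]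
  have hfix : ∀ K : ℝ, 1 < K → ∀ t,
      (IsFixedAngle K θ (angleOf θ t) ↔ rayCubic K (Real.tan θ) t = 0) := fun K hK t => by
    rw [isFixedAngle_iff_rayCubic hK hc, tan_angleOf]
    simp [cos_angleOf_ne_zero]
  have hsurj : ∀ K : ℝ, 1 < K → ∀ ψ ∈ Set.Ioc (-π) π, IsFixedAngle K θ ψ →
      ∃ t, rayCubic K (Real.tan θ) t = 0 ∧ angleOf θ t = ψ := fun K hK ψ hψ h => by
    obtain ⟨h1, h2⟩ := (isFixedAngle_iff_rayCubic hK hc).1 h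
    exact ⟨_, h2, angleOf_tan hψ h1⟩
  have hmul : ∀ K : ℝ, 1 < K → ∀ t, rayCubic K (Real.tan θ) t = 0 →
      2 * K / (1 + (K ^ 2 - 1) * Real.cos (angleOf θ t - θ) ^ 2) =
        2 * (1 + K ^ 2 * t ^ 2) / (K * (1 + t ^ 2)) := fun K hK t h => by
    rw [multiplier_eq hK hc ((hfix K hK t).2 h), tan_angleOf]
  rcases lt_or_gt_of_ne hθ0 with hneg | hpos
  · have hroot : ∀ K t, rayCubic K (-Real.tan θ) t = 0 ↔ rayCubic K (Real.tan θ) (-t) = 0 := by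
      intro K t
      rw [← neg_neg t, rayCubic_neg, neg_eq_zero, neg_neg]
    refine ⟨-Real.tan θ, neg_pos.2 (Real.tan_neg_of_neg_of_pi_div_two_lt hneg hθ.1),
      fun t => angleOf θ (-t), fun s t h => neg_injective (hinj h), fun t => angleOf_mem _ _,
      fun K hK => ⟨fun t => ?_, fun ψ hψ h => ?_, fun t h => ?_⟩⟩
    · rw [hroot, hfix K hK]
    · obtain ⟨t, h1, h2⟩ := hsurj K hK ψ hψ h
      exact ⟨-t, by rwa [hroot, neg_neg], by simpa using h2⟩
    · simpa using hmul K hK (-t) ((hroot K t).1 h)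
  · exact ⟨Real.tan θ, Real.tan_pos_of_pos_of_lt_pi_div_two hpos hθ.2, angleOf θ, hinj,
      angleOf_mem θ, fun K hK => ⟨hfix K hK, hsurj K hK, hmul K hK⟩⟩

theorem one_lt_multiplier {K t : ℝ} (hK : 1 < K) (h : K - 2 < (2 * K - 1) * K * t ^ 2) :
    1 < 2 * (1 + K ^ 2 * t ^ 2) / (K * (1 + t ^ 2)) := by
  rw [one_lt_div (by positivity)]
  linarith

theorem multiplier_lt_one {K t : ℝ} (hK : 1 < K) (h : (2 * K - 1) * K * t ^ 2 < K - 2) :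
    2 * (1 + K ^ 2 * t ^ 2) / (K * (1 + t ^ 2)) < 1 := by
  rw [div_lt_one (by positivity)]
  linarith

theorem multiplier_eq_one {K t : ℝ} (hK : 1 < K) (h : (2 * K - 1) * K * t ^ 2 = K - 2) :
    2 * (1 + K ^ 2 * t ^ 2) / (K * (1 + t ^ 2)) = 1 := by
  rw [div_eq_one_iff_eq (by positivity)]
  linarith

/-- trichotomy for the number of fixed rays of `H_{K,θ}`, `θ ≠ 0`. -/
theorem fixed_ray_trichotomy (θ : ℝ) (hθ : θ ∈ Set.Ioo (-(π / 2)) (π / 2)) (hθ0 : θ ≠ 0) :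
    ∃ Kθ : ℝ, 2 < Kθ ∧
      (∀ K : ℝ, 1 < K → K < Kθ →
        ∃ φ : ℝ, φ ∈ Set.Ioc (-π) π ∧ IsFixedAngle K θ φ ∧ IsRepelling K θ φ ∧
          ∀ ψ : ℝ, ψ ∈ Set.Ioc (-π) π → IsFixedAngle K θ ψ → ψ = φ) ∧
      (∃ φ₁ φ₂ : ℝ, φ₁ ≠ φ₂ ∧
        φ₁ ∈ Set.Ioc (-π) π ∧ φ₂ ∈ Set.Ioc (-π) π ∧
        IsFixedAngle Kθ θ φ₁ ∧ IsFixedAngle Kθ θ φ₂ ∧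
        IsRepelling Kθ θ φ₁ ∧ IsNeutral Kθ θ φ₂ ∧
        ∀ ψ : ℝ, ψ ∈ Set.Ioc (-π) π → IsFixedAngle Kθ θ ψ → ψ = φ₁ ∨ ψ = φ₂) ∧
      (∀ K : ℝ, Kθ < K →
        ∃ φ₀ φ₁ φ₂ : ℝ, φ₀ ≠ φ₁ ∧ φ₀ ≠ φ₂ ∧ φ₁ ≠ φ₂ ∧
          φ₀ ∈ Set.Ioc (-π) π ∧ φ₁ ∈ Set.Ioc (-π) π ∧ φ₂ ∈ Set.Ioc (-π) π ∧
          IsFixedAngle K θ φ₀ ∧ IsFixedAngle K θ φ₁ ∧ IsFixedAngle K θ φ₂ ∧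
          IsAttracting K θ φ₀ ∧ IsRepelling K θ φ₁ ∧ IsRepelling K θ φ₂ ∧
          ∀ ψ : ℝ, ψ ∈ Set.Ioc (-π) π → IsFixedAngle K θ ψ → ψ = φ₀ ∨ ψ = φ₁ ∨ ψ = φ₂) := by
  obtain ⟨m, hm, f, hinj, hmem, hf⟩ := exists_fixedAngle_param hθ hθ0
  obtain ⟨L, hL, hLm⟩ := exists_critValue_eq hm
  have repelling_neg : ∀ K t : ℝ, 1 < K → t < 0 → rayCubic K m t = 0 → IsRepelling K θ (f t) := by
    intro K t hK ht h
    rw [IsRepelling, (hf K hK).2.2 t h]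
    exact one_lt_multiplier hK
      (repelling_of_bound hK ht.ne (rayCubic_root_neg_bound hK hm ht h))
  refine ⟨L, hL, fun K hK hKL => ?_, ?_, fun K hKL => ?_⟩
  · obtain ⟨hfix, hsurj, -⟩ := hf K hK
    obtain ⟨t, ht, hr⟩ := exists_neg_root_rayCubic hK hm
    refine ⟨f t, hmem t, (hfix t).2 hr, repelling_neg K t hK ht hr, fun ψ hψ h => ?_⟩
    obtain ⟨s, hs, rfl⟩ := hsurj ψ hψ h
    rcases lt_or_gt_of_ne (rayCubic_root_ne_zero hm hs) with hneg | hpos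
    · rw [rayCubic_neg_root_unique hK hm hneg ht hs hr]
    · have hK2 : 2 < K := by
        have := rayCubic_root_pos_bound hK hm hpos hs
        have : 0 < K * s ^ 2 := by positivity
        linarith
      have hc := (rayCubic_critRoot_sign hK2 hm).1 (hLm ▸ critValue_lt hK2 hKL)
      exact absurd (rayCubic_pos_root_eq hK2 hpos hc.le hs).2 hc.ne'
  · have hK : 1 < L := by linarith
    obtain ⟨hfix, hsurj, hmul⟩ := hf L hK
    obtain ⟨t, ht, hr⟩ := exists_neg_root_rayCubic hK hm
    have hc := (rayCubic_critRoot_sign hL hm).2.1 hLm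
    refine ⟨f t, f (critRoot L), hinj.ne (ht.trans (critRoot_pos hL)).ne, hmem _, hmem _,
      (hfix _).2 hr, (hfix _).2 hc, repelling_neg L t hK ht hr, ?_, fun ψ hψ h => ?_⟩
    · rw [IsNeutral, hmul _ hc]
      exact multiplier_eq_one hK (critRoot_sq hL)
    · obtain ⟨s, hs, rfl⟩ := hsurj ψ hψ h
      rcases lt_or_gt_of_ne (rayCubic_root_ne_zero hm hs) with hneg | hpos
      · exact Or.inl (by rw [rayCubic_neg_root_unique hK hm hneg ht hs hr])
      · exact Or.inr (by rw [(rayCubic_pos_root_eq hL hpos hc.ge hs).1])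
  · have hK2 : 2 < K := hL.trans hKL
    have hK : 1 < K := by linarith
    obtain ⟨hfix, hsurj, hmul⟩ := hf K hK
    obtain ⟨t, ht, hr⟩ := exists_neg_root_rayCubic hK hm
    have hc := (rayCubic_critRoot_sign hK2 hm).2.2 (hLm ▸ critValue_lt hL hKL)
    obtain ⟨t₁, t₂, h0, h1, h2, hr₁, hr₂⟩ := exists_pos_roots_rayCubic hK2 hm hc
    have hsq := critRoot_sq hK2
    have hcoef : 0 < (2 * K - 1) * K := mul_pos (by linarith) (by linarith)
    have h01 : t₁ ≠ t := by linarith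
    have h02 : t₁ ≠ t₂ := by linarith
    have h12 : t ≠ t₂ := by linarith
    refine ⟨f t₁, f t, f t₂, hinj.ne h01, hinj.ne h02, hinj.ne h12, hmem _, hmem _, hmem _,
      (hfix _).2 hr₁, (hfix _).2 hr, (hfix _).2 hr₂, ?_, repelling_neg K t hK ht hr, ?_,
      fun ψ hψ h => ?_⟩
    · rw [IsAttracting, hmul _ hr₁]
      refine multiplier_lt_one hK (hsq ▸ ?_)
      gcongr
    · rw [IsRepelling, hmul _ hr₂]
      refine one_lt_multiplier hK (hsq ▸ ?_)
      have := critRoot_pos hK2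
      gcongr
    · obtain ⟨s, hs, rfl⟩ := hsurj ψ hψ h
      rcases rayCubic_root_cases hK h01 h02 h12 hr₁ hr hr₂ hs with h | h | h <;> simp [h]
end

section
/- Let K > 1 and θ ∈ (−π/2, π/2], and write H = H_{K,θ}. Suppose there is exactly one φ ∈ (−π, π] such that R_φ is a fixed ray of H. Then the set {z ∈ ℂ : H^k(z) ∈ R_φ for some integer k ≥ 0} is dense in ℂ. -/
open Real Complex Filter Topology

/-- The Boole-type map `x ↦ a (x - 1/x) + b` of the real line. -/
noncomputable def booleMap (a b x : ℝ) : ℝ := a * (x - 1 / x) + b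

/-- The quadratic polynomial whose nonzero real roots are the fixed points of `booleMap a b`. -/
noncomputable def booleQuad (a b x : ℝ) : ℝ := (1 - a) * x ^ 2 - b * x + a

lemma continuous_booleQuad (a b : ℝ) : Continuous (booleQuad a b) := by
  unfold booleQuad; fun_prop

lemma booleMap_eq_sub {a b x : ℝ} (hx : x ≠ 0) :
    booleMap a b x = x - booleQuad a b x / x := by
  unfold booleMap booleQuad; field_simp; ring

lemma booleQuad_booleMap {a b x : ℝ} (hx : x ≠ 0) :
    booleQuad a b (booleMap a b x) * x ^ 2 =
      a * booleQuad a b x * (a * x ^ 2 + b * x + (1 - a)) := by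
  unfold booleMap booleQuad; field_simp; ring

lemma hasDerivAt_booleMap {a b x : ℝ} (hx : x ≠ 0) :
    HasDerivAt (booleMap a b) (a * (1 + 1 / x ^ 2)) x := by
  have h := (((hasDerivAt_id x).sub (hasDerivAt_inv hx)).const_mul a).add_const b
  refine (h.congr_of_eventuallyEq (Eventually.of_forall fun y => ?_)).congr_deriv ?_
  · simp [booleMap]
  · simp [one_div]

lemma booleQuad_pos {a b : ℝ} (ha : 0 < a) (hfix : ∀ x, x ≠ 0 → booleMap a b x ≠ x) (x : ℝ) :
    0 < booleQuad a b x := by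
  by_contra! hx
  obtain ⟨y, hy⟩ : (0 : ℝ) ∈ Set.range (booleQuad a b) :=
    mem_range_of_exists_le_of_exists_ge (continuous_booleQuad a b) ⟨x, hx⟩
      ⟨0, by simp [booleQuad, ha.le]⟩
  have hy0 : y ≠ 0 := by
    rintro rfl
    simp [booleQuad] at hy
    exact ha.ne' hy
  exact hfix y hy0 (by rw [booleMap_eq_sub hy0, hy]; simp)

/-- A primitive of `1 / booleQuad a b`. -/
noncomputable def boolePrim (a b x : ℝ) : ℝ := ∫ t in (0 : ℝ)..x, (booleQuad a b t)⁻¹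

section Expansion

variable {a b : ℝ} (hQ : ∀ x, 0 < booleQuad a b x)
include hQ

lemma hasDerivAt_boolePrim (x : ℝ) :
    HasDerivAt (boolePrim a b) (booleQuad a b x)⁻¹ x :=
  (((continuous_booleQuad a b).inv₀ fun y => (hQ y).ne').integral_hasStrictDerivAt 0 x).hasDerivAt

lemma exists_le_booleQuad (s : ℝ) :
    ∃ ε > 0, ∀ x, |x| ≤ s → ε ≤ booleQuad a b x := by
  rcases lt_or_ge s 0 with hs | hs
  · exact ⟨1, one_pos, fun x hx => absurd (abs_nonneg x) (by linarith)⟩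
  · obtain ⟨y, -, hy⟩ := (isCompact_Icc (a := -s) (b := s)).exists_isMinOn
      ⟨0, by simp [hs]⟩ (continuous_booleQuad a b).continuousOn
    exact ⟨_, hQ y, fun x hx => hy (abs_le.mp hx)⟩

lemma booleDenom_pos (ha : 0 < a) {x : ℝ} (hx : x ≠ 0) :
    0 < a * x ^ 2 + b * x + (1 - a) := by
  have h := booleQuad_booleMap (a := a) (b := b) hx
  have h1 : 0 < booleQuad a b (booleMap a b x) * x ^ 2 := mul_pos (hQ _) (by positivity)
  rw [h] at h1
  exact pos_of_mul_pos_right h1 (mul_pos ha (hQ x)).le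

/-- Infinitesimal expansion of the metric `dx / booleQuad a b x` under `booleMap a b`. -/
lemma le_deriv_booleMap (ha : 0 < a) {l x : ℝ} (hx : x ≠ 0)
    (hl : l * (a * x ^ 2 + b * x + (1 - a)) ≤ x ^ 2 + 1) :
    l * (booleQuad a b x)⁻¹ ≤
      (booleQuad a b (booleMap a b x))⁻¹ * (a * (1 + 1 / x ^ 2)) := by
  have hD := booleDenom_pos hQ ha hx
  have hq := hQ x
  have h : booleQuad a b (booleMap a b x) =
      a * booleQuad a b x * (a * x ^ 2 + b * x + (1 - a)) / x ^ 2 := by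
    rw [← booleQuad_booleMap hx]; field_simp
  rw [h]
  have h2 : (a * booleQuad a b x * (a * x ^ 2 + b * x + (1 - a)) / x ^ 2)⁻¹ *
      (a * (1 + 1 / x ^ 2)) =
      (x ^ 2 + 1) / (a * x ^ 2 + b * x + (1 - a)) * (booleQuad a b x)⁻¹ := by
    have := hD.ne'
    field_simp
  rw [h2]
  gcongr
  rwa [le_div_iff₀ hD]

lemma boolePrim_sub_le (ha : 0 < a) {l x y : ℝ} (hxy : x ≤ y)
    (h0 : ∀ t ∈ Set.Icc x y, t ≠ 0)
    (hl : ∀ t ∈ Set.Icc x y, l * (a * t ^ 2 + b * t + (1 - a)) ≤ t ^ 2 + 1) :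
    l * (boolePrim a b y - boolePrim a b x) ≤
      boolePrim a b (booleMap a b y) - boolePrim a b (booleMap a b x) := by
  have hd : ∀ t ∈ Set.Icc x y,
      HasDerivAt (fun t => boolePrim a b (booleMap a b t) - l * boolePrim a b t)
        ((booleQuad a b (booleMap a b t))⁻¹ * (a * (1 + 1 / t ^ 2)) -
          l * (booleQuad a b t)⁻¹) t := fun t ht =>
    ((hasDerivAt_boolePrim hQ _).comp t (hasDerivAt_booleMap (h0 t ht))).sub
      ((hasDerivAt_boolePrim hQ t).const_mul l)
  have hmono := monotoneOn_of_deriv_nonneg (convex_Icc x y)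
    (fun t ht => (hd t ht).continuousAt.continuousWithinAt)
    (fun t ht => (hd t (interior_subset ht)).differentiableAt.differentiableWithinAt)
    (fun t ht => by
      have ht' := interior_subset ht
      rw [(hd t ht').deriv]
      linarith [le_deriv_booleMap hQ ha (h0 t ht') (hl t ht')])
  have := hmono (Set.left_mem_Icc.mpr hxy) (Set.right_mem_Icc.mpr hxy) hxy
  simp only at this
  linarith

lemma boolePrim_sub_le_div {ε x y : ℝ} (hε : 0 < ε) (hxy : x ≤ y)
    (h : ∀ t ∈ Set.Icc x y, ε ≤ booleQuad a b t) :
    boolePrim a b y - boolePrim a b x ≤ ε⁻¹ * (y - x) := by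
  refine (convex_Icc x y).image_sub_le_mul_sub_of_deriv_le
    (fun t _ => (hasDerivAt_boolePrim hQ t).continuousAt.continuousWithinAt)
    (fun t _ => (hasDerivAt_boolePrim hQ t).differentiableAt.differentiableWithinAt)
    (fun t ht => ?_) x (Set.left_mem_Icc.mpr hxy) y (Set.right_mem_Icc.mpr hxy) hxy
  rw [(hasDerivAt_boolePrim hQ t).deriv]
  exact inv_anti₀ hε (h t (interior_subset ht))

lemma strictMono_boolePrim : StrictMono (boolePrim a b) :=
  strictMono_of_deriv_pos fun x => by
    rw [(hasDerivAt_boolePrim hQ x).deriv]; exact inv_pos.mpr (hQ x)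

/-- An orbit of `booleMap a b` that avoids `0` changes sign. -/
lemma exists_iterate_mul_neg {x : ℝ} (h0 : ∀ k, (booleMap a b)^[k] x ≠ 0) :
    ∃ j, (booleMap a b)^[j] x * (booleMap a b)^[j + 1] x < 0 := by
  by_contra! hpos
  obtain ⟨ε, hε, hle⟩ := exists_le_booleQuad hQ |x|
  have hx : 0 < |x| := abs_pos.mpr (h0 0)
  have key : ∀ k : ℕ, |(booleMap a b)^[k] x| ≤ |x| - k * (ε / |x|) := by
    intro k
    induction k with
    | zero => simp
    | succ k ih =>
      have hp := hpos k
      have hk := h0 k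
      rw [Function.iterate_succ_apply'] at hp ⊢
      have hk1 := h0 (k + 1)
      rw [Function.iterate_succ_apply'] at hk1
      generalize (booleMap a b)^[k] x = u at *
      have hux : |u| ≤ |x| := ih.trans (by simp; positivity)
      have hu : 0 < |u| := abs_pos.mpr hk
      have hstep : |booleMap a b u| = |u| - booleQuad a b u / |u| := by
        rcases lt_or_gt_of_ne hk with h | h
        · have : booleMap a b u < 0 :=
            lt_of_le_of_ne (nonpos_of_mul_nonneg_right hp h) hk1
          rw [abs_of_neg this, abs_of_neg h, booleMap_eq_sub hk, div_neg]; ring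
        · have : 0 ≤ booleMap a b u := nonneg_of_mul_nonneg_right hp h
          rw [abs_of_nonneg this, abs_of_pos h, booleMap_eq_sub hk]
      have : ε / |x| ≤ booleQuad a b u / |u| :=
        div_le_div₀ (hQ u).le (hle u hux) hu hux
      rw [hstep]; push_cast; linarith
  obtain ⟨n, hn⟩ := exists_nat_gt (|x| / (ε / |x|))
  rw [div_lt_iff₀ (by positivity)] at hn
  linarith [key n, abs_nonneg ((booleMap a b)^[n] x)]

end Expansion

/-- The orbit of the interval `[x, y]` under `booleMap a b` never meets the pole. -/
def AvoidsPole (a b x y : ℝ) : Prop :=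
  x < y ∧ ∀ k : ℕ, ∀ t ∈ Set.Icc x y, (booleMap a b)^[k] t ≠ 0

lemma AvoidsPole.same_sign {a b x y : ℝ} (h : AvoidsPole a b x y) : 0 < x * y := by
  by_contra! hn
  refine h.2 0 0 ⟨?_, ?_⟩ rfl
  · by_contra! hx; nlinarith [h.1]
  · by_contra! hy; nlinarith [h.1]

lemma AvoidsPole.map {a b x y : ℝ} (ha : 0 < a) (h : AvoidsPole a b x y) :
    AvoidsPole a b (booleMap a b x) (booleMap a b y) := by
  have h0 : ∀ t ∈ Set.Icc x y, t ≠ 0 := h.2 0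
  have hc : ContinuousOn (booleMap a b) (Set.Icc x y) := fun t ht =>
    (hasDerivAt_booleMap (h0 t ht)).continuousAt.continuousWithinAt
  have hmono : StrictMonoOn (booleMap a b) (Set.Icc x y) :=
    strictMonoOn_of_deriv_pos (convex_Icc x y) hc fun t ht => by
      rw [(hasDerivAt_booleMap (h0 t (interior_subset ht))).deriv]; positivity
  refine ⟨hmono (Set.left_mem_Icc.mpr h.1.le) (Set.right_mem_Icc.mpr h.1.le) h.1, ?_⟩
  intro k t ht
  obtain ⟨s, hs, rfl⟩ := intermediate_value_Icc h.1.le hc ht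
  exact h.2 (k + 1) s hs

lemma abs_lt_of_mul_booleMap_neg {a b x : ℝ} (ha : 0 < a) (hx : x ≠ 0)
    (h : x * booleMap a b x < 0) : |x| < 1 + |b| / a := by
  have h1 : x * booleMap a b x = a * (x ^ 2 - 1) + b * x := by
    unfold booleMap; field_simp
  rw [h1, ← sq_abs] at h
  have h2 : -(|b| * |x|) ≤ b * x := by rw [← abs_mul]; exact neg_abs_le _
  have h3 : a * (1 + |b| / a) = a + |b| := by field_simp
  by_contra! hge
  have h4 : a + |b| ≤ a * |x| := by rw [← h3]; gcongr
  have h5 : 1 ≤ |x| := le_trans (by simp; positivity) hge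
  nlinarith [abs_nonneg x]

/-- If `booleMap a b` has no real fixed point, the backward orbit of its pole meets every
nondegenerate interval. -/
theorem not_avoidsPole {a b : ℝ} (ha : 0 < a) (hfix : ∀ x, x ≠ 0 → booleMap a b x ≠ x)
    (x y : ℝ) : ¬ AvoidsPole a b x y := by
  intro hxy
  have hQ := booleQuad_pos ha hfix
  set s := 1 + |b| / a with hs
  have hs0 : 0 < s := by positivity
  obtain ⟨ε, hε, hle⟩ := exists_le_booleQuad hQ s
  set M := a * s ^ 2 + |b| * s + 1 with hM
  have hM0 : 0 < M := by positivity
  set l := 1 + ε / M with hl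
  have hl1 : 1 < l := by rw [hl]; simp; positivity
  have hexp : ∀ x y, AvoidsPole a b x y →
      boolePrim a b y - boolePrim a b x ≤
        boolePrim a b (booleMap a b y) - boolePrim a b (booleMap a b x) := by
    intro x y h
    have := boolePrim_sub_le (l := 1) hQ ha h.1.le (h.2 0) fun t ht => by
      have := hQ t
      unfold booleQuad at this
      linarith
    linarith
  have hmem : ∀ x y, AvoidsPole a b x y → x * booleMap a b x < 0 →
      ∀ t ∈ Set.Icc x y, |t| ≤ s := by
    intro x y h hx t ht
    have hy : y * booleMap a b y < 0 := by
      have h1 := h.same_sign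
      have h2 := (h.map ha).same_sign
      by_contra! hy
      nlinarith [mul_pos h1 h2, mul_nonneg_of_nonpos_of_nonpos hx.le (neg_nonpos.mpr hy)]
    have hx' := abs_lt_of_mul_booleMap_neg (x := x) ha (h.2 0 x (Set.left_mem_Icc.mpr h.1.le)) hx
    have hy' := abs_lt_of_mul_booleMap_neg (x := y) ha (h.2 0 y (Set.right_mem_Icc.mpr h.1.le)) hy
    rw [abs_lt] at hx' hy'
    rw [abs_le]
    constructor <;> linarith [ht.1, ht.2]
  have hexp' : ∀ x y, AvoidsPole a b x y → x * booleMap a b x < 0 →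
      l * (boolePrim a b y - boolePrim a b x) ≤
        boolePrim a b (booleMap a b y) - boolePrim a b (booleMap a b x) := by
    intro x y h hx
    refine boolePrim_sub_le hQ ha h.1.le (h.2 0) fun t ht => ?_
    have hts := hmem x y h hx t ht
    have hD := booleDenom_pos hQ ha (h.2 0 t ht)
    have hDM : a * t ^ 2 + b * t + (1 - a) ≤ M := by
      have h1 : t ^ 2 ≤ s ^ 2 := sq_le_sq.mpr (by rwa [abs_of_pos hs0])
      have h2 : b * t ≤ |b| * s :=
        (le_abs_self _).trans (by rw [abs_mul]; gcongr)
      have h3 : a * t ^ 2 ≤ a * s ^ 2 := by gcongr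
      linarith
    have h4 : ε / M * (a * t ^ 2 + b * t + (1 - a)) ≤ ε :=
      calc _ ≤ ε / M * M := by gcongr
        _ = ε := by field_simp
    have h5 := hle t hts
    unfold booleQuad at h5
    rw [hl]
    linarith
  have hcross : ∀ x y, AvoidsPole a b x y → ∃ x' y', AvoidsPole a b x' y' ∧
      x' * booleMap a b x' < 0 ∧
      boolePrim a b y - boolePrim a b x ≤ boolePrim a b y' - boolePrim a b x' := by
    intro x y h
    have hit : ∀ j, AvoidsPole a b ((booleMap a b)^[j] x) ((booleMap a b)^[j] y) ∧
        boolePrim a b y - boolePrim a b x ≤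
          boolePrim a b ((booleMap a b)^[j] y) - boolePrim a b ((booleMap a b)^[j] x) := by
      intro j
      induction j with
      | zero => exact ⟨h, le_rfl⟩
      | succ j ih =>
        simp only [Function.iterate_succ_apply']
        exact ⟨ih.1.map ha, ih.2.trans (hexp _ _ ih.1)⟩
    obtain ⟨j, hj⟩ := exists_iterate_mul_neg hQ fun k => h.2 k x (Set.left_mem_Icc.mpr h.1.le)
    rw [Function.iterate_succ_apply'] at hj
    exact ⟨_, _, (hit j).1, hj, (hit j).2⟩
  have hgrow : ∀ n : ℕ, ∃ x' y', AvoidsPole a b x' y' ∧ x' * booleMap a b x' < 0 ∧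
      l ^ n * (boolePrim a b y - boolePrim a b x) ≤ boolePrim a b y' - boolePrim a b x' := by
    intro n
    induction n with
    | zero => simpa using hcross x y hxy
    | succ n ih =>
      obtain ⟨x₁, y₁, h₁, hneg, hle₁⟩ := ih
      obtain ⟨x₂, y₂, h₂, hneg₂, hle₂⟩ := hcross _ _ (h₁.map ha)
      refine ⟨x₂, y₂, h₂, hneg₂, ?_⟩
      calc _ = l * (l ^ n * (boolePrim a b y - boolePrim a b x)) := by ring
        _ ≤ l * (boolePrim a b y₁ - boolePrim a b x₁) := by gcongr
        _ ≤ _ := (hexp' _ _ h₁ hneg).trans hle₂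
  have hL : 0 < boolePrim a b y - boolePrim a b x :=
    sub_pos.mpr (strictMono_boolePrim hQ hxy.1)
  obtain ⟨n, hn⟩ := pow_unbounded_of_one_lt
    (ε⁻¹ * (2 * s) / (boolePrim a b y - boolePrim a b x)) hl1
  rw [div_lt_iff₀ hL] at hn
  obtain ⟨x', y', h', hneg, hle'⟩ := hgrow n
  have hm := hmem x' y' h' hneg
  have hb := boolePrim_sub_le_div hQ hε h'.1.le fun t ht => hle t (hm t ht)
  have hx' := abs_le.mp (hm x' (Set.left_mem_Icc.mpr h'.1.le))
  have hy' := abs_le.mp (hm y' (Set.right_mem_Icc.mpr h'.1.le))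
  have : ε⁻¹ * (y' - x') ≤ ε⁻¹ * (2 * s) := by gcongr; linarith
  linarith

/-- The quadratic map `w ↦ A w² + B conj(w)²`. -/
noncomputable def quadPair (A B w : ℂ) : ℂ := A * w ^ 2 + B * (starRingEnd ℂ w) ^ 2

lemma quadPair_im {A B : ℂ} (h : (A + B).im = 0) (w : ℂ) :
    (quadPair A B w).im = 2 * (A - B).re * (w.re * w.im) := by
  simp only [add_im] at h
  simp [quadPair, pow_two]
  linear_combination (w.re ^ 2 - w.im ^ 2) * h

lemma quadPair_re (A B w : ℂ) :
    (quadPair A B w).re =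
      (A + B).re * (w.re ^ 2 - w.im ^ 2) - 2 * (A - B).im * (w.re * w.im) := by
  simp [quadPair, pow_two]
  ring

lemma quadPair_re_div_im {A B : ℂ} (h : (A + B).im = 0) (hm : (A - B).re ≠ 0) {w : ℂ}
    (hre : w.re ≠ 0) (him : w.im ≠ 0) :
    (quadPair A B w).re / (quadPair A B w).im =
      booleMap ((A + B).re / (2 * (A - B).re)) (-(A - B).im / (A - B).re) (w.re / w.im) := by
  rw [quadPair_im h, quadPair_re, booleMap]
  field_simp
  ring

/-- The square-root parametrisation `w ↦ e^{iφ} w²` of the plane, sending `ℝ` onto `R_φ`. -/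
noncomputable def raySq (φ : ℝ) (w : ℂ) : ℂ := Complex.exp ((φ : ℂ) * Complex.I) * w ^ 2

lemma continuous_raySq (φ : ℝ) : Continuous (raySq φ) := by unfold raySq; fun_prop

lemma raySq_surjective (φ : ℝ) : Function.Surjective (raySq φ) := by
  intro z
  obtain ⟨w, hw⟩ := IsAlgClosed.exists_pow_nat_eq
    (z * Complex.exp (-((φ : ℂ) * Complex.I))) (n := 2) two_pos
  refine ⟨w, ?_⟩
  rw [raySq, hw, mul_left_comm, ← Complex.exp_add]
  simp

lemma raySq_mem_ray {φ : ℝ} {w : ℂ} (hw : w.im = 0) : raySq φ w ∈ Ray φ := by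
  refine ⟨w.re ^ 2, by positivity, ?_⟩
  have : w = (w.re : ℂ) := Complex.ext rfl (by simp [hw])
  rw [raySq, this]
  push_cast
  simp [mul_comm]

/-- The coefficient of `w²` in the lift of `H_{K,θ}` along `raySq φ`. -/
noncomputable def liftCoeff (K φ : ℝ) : ℂ :=
  Complex.exp (((φ / 2 : ℝ) : ℂ) * Complex.I) * (((K + 1) / 2 : ℝ) : ℂ)

/-- The coefficient of `conj(w)²` in the lift of `H_{K,θ}` along `raySq φ`. -/
noncomputable def liftCoeffConj (K θ φ : ℝ) : ℂ :=
  Complex.exp (((2 * θ - 3 * φ / 2 : ℝ) : ℂ) * Complex.I) * (((K - 1) / 2 : ℝ) : ℂ)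

lemma hK_raySq (K θ φ : ℝ) (w : ℂ) :
    hK K θ (raySq φ w) = Complex.exp (((φ / 2 : ℝ) : ℂ) * Complex.I) *
      quadPair (liftCoeff K φ) (liftCoeffConj K θ φ) w := by
  have h1 : Complex.exp ((φ : ℂ) * Complex.I) = Complex.exp (((φ / 2 : ℝ) : ℂ) * Complex.I) *
      Complex.exp (((φ / 2 : ℝ) : ℂ) * Complex.I) := by
    rw [← Complex.exp_add]; congr 1; push_cast; ring
  have h2 : Complex.exp (2 * (θ : ℂ) * Complex.I) * Complex.exp (-((φ : ℂ) * Complex.I)) =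
      Complex.exp (((φ / 2 : ℝ) : ℂ) * Complex.I) *
        Complex.exp (((2 * θ - 3 * φ / 2 : ℝ) : ℂ) * Complex.I) := by
    rw [← Complex.exp_add, ← Complex.exp_add]; congr 1; push_cast; ring
  have h3 : (starRingEnd ℂ) (Complex.exp ((φ : ℂ) * Complex.I)) =
      Complex.exp (-((φ : ℂ) * Complex.I)) := by
    rw [← Complex.exp_conj]; simp
  rw [hK, raySq, quadPair, liftCoeff, liftCoeffConj, map_mul, map_pow, h3]
  linear_combination (((K + 1) / 2 : ℝ) : ℂ) * w ^ 2 * h1 +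
    (((K - 1) / 2 : ℝ) : ℂ) * (starRingEnd ℂ) w ^ 2 * h2

lemma HK_raySq (K θ φ : ℝ) (w : ℂ) :
    HK K θ (raySq φ w) = raySq φ (quadPair (liftCoeff K φ) (liftCoeffConj K θ φ) w) := by
  rw [HK, hK_raySq, raySq, mul_pow, ← Complex.exp_nat_mul]
  congr 2
  push_cast; ring

lemma HK_iterate_raySq (K θ φ : ℝ) (k : ℕ) (w : ℂ) :
    (HK K θ)^[k] (raySq φ w) =
      raySq φ ((quadPair (liftCoeff K φ) (liftCoeffConj K θ φ))^[k] w) :=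
  ((Function.Semiconj.iterate_right (fun w => (HK_raySq K θ φ w).symm) k) w).symm

lemma liftCoeff_normSq_sub (K θ φ : ℝ) :
    Complex.normSq (liftCoeff K φ) - Complex.normSq (liftCoeffConj K θ φ) = K := by
  simp only [Complex.normSq_eq_norm_sq, liftCoeff, liftCoeffConj, norm_mul,
    Complex.norm_exp_ofReal_mul_I, Complex.norm_real, one_mul, Real.norm_eq_abs, sq_abs]
  ring

lemma liftCoeff_add_im {K θ φ : ℝ} (hfix : IsFixedAngle K θ φ) :
    (liftCoeff K φ + liftCoeffConj K θ φ).im = 0 := by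
  obtain ⟨t, ht, h⟩ := hfix
  have h1 : Complex.exp ((φ : ℂ) * Complex.I) = raySq φ 1 := by simp [raySq]
  have h2 := HK_raySq K θ φ 1
  rw [← h1, h, raySq, mul_comm, mul_right_inj' (Complex.exp_ne_zero _)] at h2
  have hq : quadPair (liftCoeff K φ) (liftCoeffConj K θ φ) 1 =
      liftCoeff K φ + liftCoeffConj K θ φ := by simp [quadPair]
  rw [hq] at h2
  generalize liftCoeff K φ + liftCoeffConj K θ φ = v at h2
  have hr := congrArg Complex.re h2
  have hi := congrArg Complex.im h2
  simp [pow_two] at hr hi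
  by_contra hv
  have hre : v.re = 0 := by
    have : v.re * v.im = 0 := by linarith
    exact (mul_eq_zero.mp this).resolve_right hv
  rw [hre] at hr
  nlinarith [mul_self_nonneg v.im]

/-- A nonreal eigendirection of the lift gives a fixed ray other than `R_φ`. -/
lemma exists_fixedAngle_ne {K θ φ c : ℝ} (hc : c ≠ 0) {w : ℂ} (hw : w.im ≠ 0)
    (h : quadPair (liftCoeff K φ) (liftCoeffConj K θ φ) w = c * w) :
    ∃ ψ ∈ Set.Ioc (-π) π, IsFixedAngle K θ ψ ∧ ψ ≠ φ := by
  have hw0 : w ≠ 0 := by rintro rfl; simp at hw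
  have hz : raySq φ w ≠ 0 := mul_ne_zero (Complex.exp_ne_zero _) (pow_ne_zero 2 hw0)
  have hpolar := Complex.norm_mul_exp_arg_mul_I (raySq φ w)
  have hn : 0 < ‖raySq φ w‖ := norm_pos_iff.mpr hz
  have hHz : HK K θ (raySq φ w) = ((c ^ 2 : ℝ) : ℂ) * raySq φ w := by
    rw [HK_raySq, h, raySq, raySq]; push_cast; ring
  refine ⟨(raySq φ w).arg, Complex.arg_mem_Ioc _, ⟨c ^ 2 / ‖raySq φ w‖, by positivity, ?_⟩, ?_⟩
  · have hhom : ∀ (r : ℝ) (v : ℂ), HK K θ (r * v) = ((r ^ 2 : ℝ) : ℂ) * HK K θ v := by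
      intro r v
      simp only [HK, hK, map_mul, Complex.conj_ofReal]
      push_cast; ring
    have hn' : (‖raySq φ w‖ : ℂ) ≠ 0 := by exact_mod_cast hn.ne'
    have h1 := hhom ‖raySq φ w‖ (Complex.exp ((raySq φ w).arg * Complex.I))
    rw [hpolar, hHz] at h1
    have h2 : ((c ^ 2 : ℝ) : ℂ) * (‖raySq φ w‖ * Complex.exp ((raySq φ w).arg * Complex.I)) =
        ((‖raySq φ w‖ ^ 2 : ℝ) : ℂ) * HK K θ (Complex.exp ((raySq φ w).arg * Complex.I)) := by
      rw [hpolar]; exact h1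
    apply mul_left_cancel₀ (pow_ne_zero 2 hn')
    push_cast at h2 ⊢
    rw [← h2]
    field_simp
  · intro hψ
    rw [hψ, mul_comm] at hpolar
    nth_rewrite 2 [raySq] at hpolar
    rw [mul_right_inj' (Complex.exp_ne_zero _)] at hpolar
    have hr := congrArg Complex.re hpolar
    have hi := congrArg Complex.im hpolar
    simp [pow_two] at hr hi
    have hre : w.re = 0 := by
      have : w.re * w.im = 0 := by linarith
      exact (mul_eq_zero.mp this).resolve_right hw
    rw [hre] at hr
    nlinarith [mul_self_pos.mpr hw]

/-- if `H` has exactly one fixed ray, its backward orbit is dense in `ℂ`. -/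
theorem preimages_of_unique_fixed_ray_dense (K θ : ℝ) (hK1 : 1 < K)
    (hθ : θ ∈ Set.Ioc (-(π / 2)) (π / 2)) (φ : ℝ) (hφ : φ ∈ Set.Ioc (-π) π)
    (hfix : IsFixedAngle K θ φ)
    (huniq : ∀ ψ : ℝ, ψ ∈ Set.Ioc (-π) π → IsFixedAngle K θ ψ → ψ = φ) :
    Dense {z : ℂ | ∃ k : ℕ, (HK K θ)^[k] z ∈ Ray φ} := by
  have him := liftCoeff_add_im hfix
  have hnorm := liftCoeff_normSq_sub K θ φ
  have hsemi := HK_iterate_raySq K θ φ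
  have hnofix : ∀ (c : ℝ) (w : ℂ), c ≠ 0 → w.im ≠ 0 →
      quadPair (liftCoeff K φ) (liftCoeffConj K θ φ) w ≠ c * w := by
    intro c w hc hw h
    obtain ⟨ψ, hψ, hψfix, hne⟩ := exists_fixedAngle_ne hc hw h
    exact hne (huniq ψ hψ hψfix)
  generalize liftCoeff K φ = A at *
  generalize liftCoeffConj K θ φ = B at *
  have hrm : (A + B).re * (A - B).re = K := by
    simp only [Complex.normSq_apply, add_im, add_re, sub_re] at *
    linear_combination hnorm - (A.im - B.im) * him
  have hrm0 : 0 < (A + B).re * (A - B).re := by linarith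
  have hm : (A - B).re ≠ 0 := right_ne_zero_of_mul hrm0.ne'
  set a := (A + B).re / (2 * (A - B).re) with ha_def
  set b := -(A - B).im / (A - B).re with hb_def
  have ha : 0 < a := by
    have : a = (A + B).re * (A - B).re / (2 * (A - B).re ^ 2) := by
      rw [ha_def]; field_simp
    rw [this]; positivity
  have hF : ∀ x, x ≠ 0 → booleMap a b x ≠ x := by
    intro x hx hxfix
    have hw := quadPair_re_div_im him hm (w := ⟨x, 1⟩) hx one_ne_zero
    simp only [div_one] at hw
    have hi := quadPair_im him ⟨x, 1⟩
    simp only [mul_one] at hi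
    have hi0 : 2 * (A - B).re * x ≠ 0 := by positivity
    refine hnofix (2 * (A - B).re * x) ⟨x, 1⟩ hi0 one_ne_zero ?_
    rw [← ha_def, ← hb_def, hxfix, hi, div_eq_iff hi0] at hw
    apply Complex.ext
    · rw [Complex.re_ofReal_mul, hw, mul_comm]
    · rw [Complex.im_ofReal_mul, hi, mul_one]
  rw [dense_iff_inter_open]
  rintro U hU ⟨z, hz⟩
  by_contra hempty
  obtain ⟨w₀, rfl⟩ := raySq_surjective φ z
  have hV : IsOpen (raySq φ ⁻¹' U) := hU.preimage (continuous_raySq φ)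
  have him_ne : ∀ w ∈ raySq φ ⁻¹' U, ∀ k, ((quadPair A B)^[k] w).im ≠ 0 := by
    intro w hw k hk
    refine hempty ⟨_, hw, k, ?_⟩
    rw [hsemi]
    exact raySq_mem_ray hk
  have hw₀ := him_ne w₀ hz 0
  simp only [Function.iterate_zero, id] at hw₀
  have hline : Continuous fun t : ℝ => (w₀.im : ℂ) * ((t : ℂ) + Complex.I) := by fun_prop
  have hx₀ : w₀.re / w₀.im ∈
      (fun t : ℝ => (w₀.im : ℂ) * ((t : ℂ) + Complex.I)) ⁻¹' (raySq φ ⁻¹' U) := by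
    have : (w₀.im : ℂ) * (((w₀.re / w₀.im : ℝ) : ℂ) + Complex.I) = w₀ := by
      apply Complex.ext
      · simp; field_simp
      · simp
    simpa only [Set.mem_preimage, this] using hz
  obtain ⟨δ, hδ, hball⟩ := Metric.isOpen_iff.mp (hV.preimage hline) _ hx₀
  refine not_avoidsPole ha hF (w₀.re / w₀.im) (w₀.re / w₀.im + δ / 2) ⟨by linarith, ?_⟩
  intro k t ht
  have htV : (w₀.im : ℂ) * ((t : ℂ) + Complex.I) ∈ raySq φ ⁻¹' U := hball (by
    rw [Metric.mem_ball, Real.dist_eq, abs_lt]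
    constructor <;> linarith [ht.1, ht.2])
  have him_t := him_ne _ htV
  set w := (w₀.im : ℂ) * ((t : ℂ) + Complex.I) with hw_def
  have hre_t : ∀ k, ((quadPair A B)^[k] w).re ≠ 0 := by
    intro k hk
    apply him_t (k + 1)
    rw [Function.iterate_succ_apply', quadPair_im him, hk]
    simp
  have hratio : ∀ k, (booleMap a b)^[k] t =
      ((quadPair A B)^[k] w).re / ((quadPair A B)^[k] w).im := by
    intro k
    induction k with
    | zero => simp [hw_def]; field_simp
    | succ k ih =>
      rw [Function.iterate_succ_apply', Function.iterate_succ_apply', ih,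
        quadPair_re_div_im him hm (hre_t k) (him_t k)]
  rw [hratio]
  exact div_ne_zero (hre_t k) (him_t k)
end

section
/- Let K > 1. If θ ∈ (0, π/2), then every fixed angle φ ∈ (−π, π] of H_{K,θ} satisfies either 2θ < φ < θ + π/2 or θ − π/2 < φ < 0. If θ = 0, then every fixed angle φ ∈ (−π, π] of H_{K,0} satisfies −π/2 < φ < π/2. If θ = π/2, then the only fixed angle of H_{K,π/2} in (−π, π] is φ = 0. -/
open Real Complex Filter Topology

/-- In the direction `ψ = φ - θ` relative to the stretching axis, the image of a fixed ray satisfies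
`(K cos ψ + i sin ψ)² = t e^{i(ψ - θ)}`. -/
theorem IsFixedAngle.exists_re_im {K θ φ : ℝ} (h : IsFixedAngle K θ φ) :
    ∃ t : ℝ, 0 < t ∧
      K ^ 2 * Real.cos (φ - θ) ^ 2 - Real.sin (φ - θ) ^ 2 = t * Real.cos (φ - θ - θ) ∧
      2 * K * Real.cos (φ - θ) * Real.sin (φ - θ) = t * Real.sin (φ - θ - θ) := by
  obtain ⟨t, ht, h⟩ := h
  obtain ⟨ψ, rfl⟩ : ∃ ψ, φ = ψ + θ := ⟨φ - θ, by ring⟩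
  simp only [add_sub_cancel_right]
  have hstretch : hK K θ (Complex.exp (((ψ + θ : ℝ) : ℂ) * I)) =
      Complex.exp (θ * I) * (K * Complex.cos ψ + Complex.sin ψ * I) := by
    have hrot : Complex.exp (2 * θ * I) * Complex.exp (-((ψ + θ : ℝ) * I)) =
        Complex.exp (θ * I) * Complex.exp (-ψ * I) := by
      rw [← Complex.exp_add, ← Complex.exp_add]
      push_cast
      ring_nf
    have hconj : (starRingEnd ℂ) (Complex.exp (((ψ + θ : ℝ) : ℂ) * I)) =
        Complex.exp (-((ψ + θ : ℝ) * I)) := by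
      rw [← Complex.exp_conj, map_mul, conj_ofReal, conj_I, mul_neg]
    have hsum : Complex.exp (((ψ + θ : ℝ) : ℂ) * I) =
        Complex.exp (θ * I) * Complex.exp (ψ * I) := by
      rw [← Complex.exp_add]
      push_cast
      ring_nf
    rw [hK, hconj, mul_right_comm, hrot, hsum, Complex.exp_mul_I (-(ψ : ℂ)),
      Complex.exp_mul_I (ψ : ℂ), Complex.cos_neg, Complex.sin_neg]
    push_cast
    ring
  have hsq : (K * Complex.cos ψ + Complex.sin ψ * I) ^ 2 =
      t * Complex.exp (((ψ - θ : ℝ) : ℂ) * I) := by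
    have hsplit : Complex.exp (((ψ + θ : ℝ) : ℂ) * I) =
        Complex.exp (θ * I) ^ 2 * Complex.exp (((ψ - θ : ℝ) : ℂ) * I) := by
      rw [← Complex.exp_nat_mul, ← Complex.exp_add]
      push_cast
      ring_nf
    rw [HK, hstretch, hsplit] at h
    refine mul_left_cancel₀ (pow_ne_zero 2 (Complex.exp_ne_zero (θ * I))) ?_
    linear_combination h
  rw [Complex.exp_mul_I, ← ofReal_cos, ← ofReal_sin, ← ofReal_cos, ← ofReal_sin] at hsq
  have hre := congrArg Complex.re hsq
  have him := congrArg Complex.im hsq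
  simp only [pow_two, mul_re, mul_im, add_re, add_im, ofReal_re, ofReal_im, I_re, I_im] at hre him
  exact ⟨t, ht, by linear_combination hre, by linear_combination him⟩

theorem IsFixedAngle.cos_pos_of_axis_zero {K φ : ℝ} (hK1 : 1 < K) (h : IsFixedAngle K 0 φ) :
    0 < Real.cos φ := by
  obtain ⟨t, ht, hre, him⟩ := h.exists_re_im
  simp only [sub_zero] at hre him
  by_cases hs : Real.sin φ = 0
  · have hc := Real.sin_sq_add_cos_sq φ
    rw [hs] at hc hre
    exact pos_of_mul_pos_right (by nlinarith : 0 < t * Real.cos φ) ht.le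
  · have : 2 * K * Real.cos φ = t := mul_right_cancel₀ hs him
    exact pos_of_mul_pos_right (by linarith : 0 < 2 * K * Real.cos φ) (by linarith)

theorem IsFixedAngle.sin_eq_zero_and_cos_pos_of_axis_pi_div_two {K φ : ℝ} (hK1 : 1 < K)
    (h : IsFixedAngle K (π / 2) φ) : Real.sin φ = 0 ∧ 0 < Real.cos φ := by
  obtain ⟨t, ht, hre, him⟩ := h.exists_re_im
  rw [show φ - π / 2 - π / 2 = φ - π by ring, Real.cos_sub_pi_div_two, Real.sin_sub_pi_div_two,
    Real.cos_sub_pi] at hre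
  rw [show φ - π / 2 - π / 2 = φ - π by ring, Real.cos_sub_pi_div_two, Real.sin_sub_pi_div_two,
    Real.sin_sub_pi] at him
  have hc := Real.sin_sq_add_cos_sq φ
  by_cases hs : Real.sin φ = 0
  · rw [hs] at hc hre
    exact ⟨hs, pos_of_mul_pos_right (by nlinarith : 0 < t * Real.cos φ) ht.le⟩
  · have : 2 * K * Real.cos φ = t := mul_right_cancel₀ hs (by linear_combination -him)
    subst this
    have : 0 < Real.sin φ ^ 2 := by positivity
    nlinarith [mul_pos (by positivity : 0 < K ^ 2) this,
      mul_nonneg (by linarith : 0 ≤ 2 * K - 1) (sq_nonneg (Real.cos φ))]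

section

variable {K t c s C S : ℝ}

/-- The two equations of a fixed ray, with `c + is = e^{iψ}` and `C + iS = e^{iθ}` for an acute
`θ`, force `c > 0`. -/
theorem stretch_fixed_cos_pos (hK1 : 1 < K) (ht : 0 < t) (hC : 0 < C) (hS : 0 < S)
    (hcs : s ^ 2 + c ^ 2 = 1) (hre : K ^ 2 * c ^ 2 - s ^ 2 = t * (c * C + s * S))
    (him : 2 * K * c * s = t * (s * C - c * S)) : 0 < c := by
  have hK0 : 0 < K := by linarith
  by_contra! hc
  rcases hc.eq_or_lt with rfl | hc
  · have hs : t * C * s = 0 := by linear_combination -him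
    have : s = 0 := by simpa [ht.ne', hC.ne'] using hs
    simp [this] at hcs
  obtain ⟨a, rfl⟩ : ∃ a, c = -a := ⟨-c, by ring⟩
  have ha : 0 < a := by linarith
  rcases le_or_gt 0 s with hs | hs
  · have h₁ : 0 < t * (s * C - -a * S) := by
      apply mul_pos ht
      have := mul_pos ha hS
      have := mul_nonneg hs hC.le
      linarith
    have h₂ : 0 ≤ K * a * s := by positivity
    linarith
  obtain ⟨b, rfl⟩ : ∃ b, s = -b := ⟨-s, by ring⟩
  have hb : 0 < b := by linarith
  have hpos : 0 < a * S - b * C := by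
    refine pos_of_mul_pos_right (a := t) ?_ ht.le
    have : 0 < 2 * K * a * b := by positivity
    linarith
  have helim : (b ^ 2 - K ^ 2 * a ^ 2) * (a * S - b * C) = 2 * K * a * b * (a * C + b * S) := by
    linear_combination -(a * S - b * C) * hre - (a * C + b * S) * him
  have h₁ : 0 < K ^ 2 * a ^ 2 * (a * S - b * C) := by positivity
  have h₂ : 0 < b ^ 3 * C := by positivity
  have h₃ : 0 < 2 * K * a ^ 2 * b * C := by positivity
  have h₄ : 0 < (K - 1) * (a * b ^ 2 * S) := mul_pos (by linarith) (by positivity)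
  have h₅ : 0 < a * b ^ 2 * S := by positivity
  linarith

/-- A fixed ray on the clockwise side of the stretching axis lies beyond the reflection of the
positive real axis: `sin (ψ + θ) < 0`. -/
theorem stretch_fixed_sin_add_neg (hK1 : 1 < K) (hC : 0 < C) (hS : 0 < S) (hc : 0 < c) (hs : s < 0)
    (hre : K ^ 2 * c ^ 2 - s ^ 2 = t * (c * C + s * S))
    (him : 2 * K * c * s = t * (s * C - c * S)) : s * C + c * S < 0 := by
  by_contra! hle
  obtain ⟨b, rfl⟩ : ∃ b, s = -b := ⟨-s, by ring⟩
  have hb : 0 < b := by linarith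
  have helim : (K ^ 2 * c ^ 2 - b ^ 2) * (b * C + c * S) = 2 * K * c * b * (c * C - b * S) := by
    linear_combination (b * C + c * S) * hre + (c * C - b * S) * him
  have hK0 : 0 < K := by linarith
  have h₁ : 0 ≤ (K ^ 2 * c ^ 2 + b ^ 2) * (-b * C + c * S) := mul_nonneg (by positivity) hle
  have h₂ : 0 < (K - 1) * (K * c ^ 2 * b * C) := mul_pos (by linarith) (by positivity)
  have h₃ : 0 < (K - 1) * (c * b ^ 2 * S) := mul_pos (by linarith) (by positivity)
  linarith

end

theorem IsFixedAngle.mem_sectors {K θ φ : ℝ} (hK1 : 1 < K) (hθ : θ ∈ Set.Ioo 0 (π / 2))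
    (hφ : φ ∈ Set.Ioc (-π) π) (h : IsFixedAngle K θ φ) :
    (2 * θ < φ ∧ φ < θ + π / 2) ∨ (θ - π / 2 < φ ∧ φ < 0) := by
  obtain ⟨hθ0, hθ1⟩ := hθ
  obtain ⟨hφ0, hφ1⟩ := hφ
  obtain ⟨t, ht, hre, him⟩ := h.exists_re_im
  have hC : 0 < Real.cos θ := Real.cos_pos_of_mem_Ioo ⟨by linarith, hθ1⟩
  have hS : 0 < Real.sin θ := Real.sin_pos_of_pos_of_lt_pi hθ0 (by linarith)
  obtain ⟨ψ, rfl⟩ : ∃ ψ, φ = ψ + θ := ⟨φ - θ, by ring⟩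
  simp only [add_sub_cancel_right] at hre him
  have hre' := hre
  have him' := him
  rw [Real.cos_sub] at hre'
  rw [Real.sin_sub] at him'
  have hc := stretch_fixed_cos_pos hK1 ht hC hS (Real.sin_sq_add_cos_sq ψ) hre' him'
  have hψ1 : ψ < π / 2 := by
    by_contra! hle
    exact hc.not_ge (Real.cos_nonpos_of_pi_div_two_le_of_le hle (by linarith))
  have hψ0 : -(π / 2) < ψ := by
    by_contra! hle
    rw [← Real.cos_neg] at hc
    exact hc.not_ge (Real.cos_nonpos_of_pi_div_two_le_of_le (by linarith) (by linarith))
  rcases lt_or_ge ψ 0 with hψ | hψ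
  · right
    have hs : Real.sin ψ < 0 := Real.sin_neg_of_neg_of_neg_pi_lt hψ (by linarith)
    have hneg := stretch_fixed_sin_add_neg hK1 hC hS hc hs hre' him'
    rw [← Real.sin_add] at hneg
    refine ⟨by linarith, ?_⟩
    by_contra! hle
    exact hneg.not_ge (Real.sin_nonneg_of_nonneg_of_le_pi hle (by linarith))
  · left
    refine ⟨?_, by linarith⟩
    by_contra! hle
    have hs : 0 ≤ Real.sin ψ := Real.sin_nonneg_of_nonneg_of_le_pi hψ (by linarith)
    have hsub : Real.sin (ψ - θ) = 0 := by
      refine le_antisymm (Real.sin_nonpos_of_nonpos_of_neg_pi_le (by linarith) (by linarith)) ?_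
      rw [← mul_nonneg_iff_of_pos_left ht, ← him]
      positivity
    have hs0 : Real.sin ψ = 0 := by
      rw [hsub, mul_zero] at him
      have hne : 2 * K * Real.cos ψ ≠ 0 := by positivity
      exact (mul_eq_zero.mp him).resolve_left hne
    rw [Real.sin_sub, hs0] at hsub
    have := mul_pos hc hS
    linarith

/-- locations of fixed angles of `H_{K,θ}`. -/
theorem fixed_angle_locations (K : ℝ) (hK1 : 1 < K) :
    (∀ θ : ℝ, θ ∈ Set.Ioo 0 (π / 2) →
      ∀ φ : ℝ, φ ∈ Set.Ioc (-π) π → IsFixedAngle K θ φ →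
        (2 * θ < φ ∧ φ < θ + π / 2) ∨ (θ - π / 2 < φ ∧ φ < 0)) ∧
    (∀ φ : ℝ, φ ∈ Set.Ioc (-π) π → IsFixedAngle K 0 φ → -(π / 2) < φ ∧ φ < π / 2) ∧
    (∀ φ : ℝ, φ ∈ Set.Ioc (-π) π → IsFixedAngle K (π / 2) φ → φ = 0) := by
  refine ⟨fun θ hθ φ hφ h => h.mem_sectors hK1 hθ hφ, fun φ ⟨hφ0, hφ1⟩ h => ?_,
    fun φ ⟨hφ0, hφ1⟩ h => ?_⟩
  · have hc := h.cos_pos_of_axis_zero hK1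
    have hπ := Real.pi_pos
    constructor <;> by_contra! hle
    · rw [← Real.cos_neg] at hc
      exact hc.not_ge (Real.cos_nonpos_of_pi_div_two_le_of_le (by linarith) (by linarith))
    · exact hc.not_ge (Real.cos_nonpos_of_pi_div_two_le_of_le hle (by linarith))
  · obtain ⟨hs, hc⟩ := h.sin_eq_zero_and_cos_pos_of_axis_pi_div_two hK1
    rcases hφ1.eq_or_lt with rfl | hφ1
    · rw [Real.cos_pi] at hc
      linarith
    · exact (Real.sin_eq_zero_iff_of_lt_of_lt hφ0 hφ1).mp hs
end

section
/- Let K > 1 and let φ ∈ (−π/2, π/2) with φ ≠ 0. If 2K = 1 + (K²−1)cos²(φ), then 2·arctan(tan(φ)/K) ≠ φ; that is, a nonzero angle in (−π/2, π/2) at which the induced argument map of H_{K,0} has derivative equal to 1 cannot be a fixed angle of H_{K,0}. -/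
open Real Complex Filter Topology

/-- a nonzero neutral angle of `H_{K,0}` cannot be fixed. -/
theorem neutral_angle_not_fixed_theta_zero (K φ : ℝ) (hK1 : 1 < K)
    (hφ : φ ∈ Set.Ioo (-(π / 2)) (π / 2)) (hφ0 : φ ≠ 0)
    (hneut : 2 * K = 1 + (K ^ 2 - 1) * Real.cos φ ^ 2) :
    2 * Real.arctan (Real.tan φ / K) ≠ φ := by
  intro h
  obtain ⟨x, hx⟩ : ∃ x, x = Real.arctan (Real.tan φ / K) := ⟨_, rfl⟩
  rw [← hx] at h
  have hcos : 0 < Real.cos φ := Real.cos_pos_of_mem_Ioo hφ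
  have hcosx : 0 < Real.cos x := hx ▸ Real.cos_arctan_pos _
  have hK0 : K ≠ 0 := by positivity
  have htan : Real.tan x = Real.tan φ / K := by rw [hx, Real.tan_arctan]
  have hsin : Real.sin x ≠ 0 := by
    intro hs
    apply hφ0
    have hlt := Real.pi_pos
    have hx0 : x = 0 := (Real.sin_eq_zero_iff_of_lt_of_lt (by linarith [hφ.1])
      (by linarith [hφ.2])).1 hs
    linarith
  rw [Real.tan_eq_sin_div_cos, Real.tan_eq_sin_div_cos] at htan
  field_simp at htan
  have hsinφ : Real.sin φ = 2 * Real.sin x * Real.cos x := by rw [← h, Real.sin_two_mul]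
  have hcosφ : Real.cos φ = 2 * Real.cos x ^ 2 - 1 := by rw [← h, Real.cos_two_mul]
  rw [hsinφ] at htan
  have hmul : K * Real.cos φ = 1 + Real.cos φ := by
    apply mul_left_cancel₀ hsin
    linear_combination htan - Real.sin x * hcosφ
  have hK2 : K = 2 := by
    have hfactor : 2 * K * (K - 1) * (K - 2) = 0 := by
      linear_combination (K - 1) ^ 2 * hneut +
        (K ^ 2 - 1) * (K * Real.cos φ - Real.cos φ + 1) * hmul
    have hK1' : K - 1 ≠ 0 := by linarith
    have hne : 2 * K * (K - 1) ≠ 0 := by positivity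
    linarith [(mul_eq_zero.1 hfactor).resolve_left hne]
  have hcos1 : Real.cos φ = 1 := by
    rw [hK2] at hmul
    linarith
  exact hφ0 ((Real.cos_eq_one_iff_of_lt_of_lt (by linarith [hφ.1, Real.pi_pos])
    (by linarith [hφ.2, Real.pi_pos])).1 hcos1)
end

section
/- Let K > 1 and θ = 0. If 1 < K < 2, then the only fixed angle of H_{K,0} in (−π, π] is φ = 0, and R_0 is locally repelling. If K = 2, then the only fixed angle of H_{2,0} in (−π, π] is φ = 0, and R_0 is neutral. If K > 2, then H_{K,0} has exactly three fixed angles in (−π, π], namely 0, φ₁ and −φ₁ for some φ₁ ∈ (0, π/2); the ray R_0 is locally attracting and the rays R_{φ₁} and R_{−φ₁} are locally repelling. -/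
open Real Complex Filter Topology

/-- In coordinates, `φ` is a fixed angle of `H_{K,0}` when `(K cos φ + i sin φ)²` is a positive
multiple of `cos φ + i sin φ`. -/
theorem isFixedAngle_zero_iff_re_im (K φ : ℝ) :
    IsFixedAngle K 0 φ ↔ ∃ t : ℝ, 0 < t ∧
      K ^ 2 * Real.cos φ ^ 2 - Real.sin φ ^ 2 = t * Real.cos φ ∧
      2 * K * Real.cos φ * Real.sin φ = t * Real.sin φ := by
  have hh : hK K 0 (Complex.exp ((φ : ℂ) * Complex.I)) = ⟨K * Real.cos φ, Real.sin φ⟩ := by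
    apply Complex.ext <;> simp [hK, Complex.exp_ofReal_mul_I_re, Complex.exp_ofReal_mul_I_im] <;>
      ring
  unfold IsFixedAngle HK
  refine exists_congr fun t => and_congr_right fun _ => ?_
  rw [hh, Complex.ext_iff, pow_two]
  simp only [Complex.mul_re, Complex.mul_im, Complex.ofReal_re, Complex.ofReal_im,
    Complex.exp_ofReal_mul_I_re, Complex.exp_ofReal_mul_I_im]
  ring_nf

/-- For `K > 1`, the fixed angles of `H_{K,0}` are determined by their cosine. -/
theorem isFixedAngle_zero_iff_cos {K : ℝ} (hK1 : 1 < K) (φ : ℝ) :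
    IsFixedAngle K 0 φ ↔ Real.cos φ = 1 ∨ (K - 1) * Real.cos φ = 1 := by
  have hsc := Real.sin_sq_add_cos_sq φ
  rw [isFixedAngle_zero_iff_re_im]
  constructor
  · rintro ⟨t, ht, hre, him⟩
    by_cases hs : Real.sin φ = 0
    · rw [hs] at hre hsc
      have hc : (Real.cos φ - 1) * (Real.cos φ + 1) = 0 := by linarith
      rcases mul_eq_zero.mp hc with h | h
      · left; linarith
      · have hc' : Real.cos φ = -1 := by linarith
        rw [hc'] at hre
        nlinarith
    · have htc : 2 * K * Real.cos φ = t := mul_right_cancel₀ hs him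
      have hc : 0 < Real.cos φ := by
        by_contra! hc
        nlinarith
      right
      have hprod : ((K - 1) * Real.cos φ - 1) * ((K - 1) * Real.cos φ + 1) = 0 := by
        subst htc
        linear_combination hre + hsc
      have hpos : 0 < (K - 1) * Real.cos φ := mul_pos (by linarith) hc
      rcases mul_eq_zero.mp hprod with h | h <;> linarith
  · rintro (hc | hc)
    · have hs : Real.sin φ = 0 := by
        rw [hc] at hsc
        exact pow_eq_zero_iff two_ne_zero |>.mp (by linarith)
      exact ⟨K ^ 2, by positivity, by simp [hc, hs], by simp [hs]⟩
    · have hpos : 0 < Real.cos φ := pos_of_mul_pos_right (by linarith) (by linarith : 0 ≤ K - 1)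
      refine ⟨2 * K * Real.cos φ, by positivity, ?_, rfl⟩
      linear_combination ((K - 1) * Real.cos φ + 1) * hc - hsc

theorem eq_zero_of_cos_eq_one_of_mem_Ioc {φ : ℝ} (hφ : φ ∈ Set.Ioc (-π) π)
    (hc : Real.cos φ = 1) : φ = 0 :=
  (Real.cos_eq_one_iff_of_lt_of_lt (by linarith [hφ.1, Real.pi_pos])
    (by linarith [hφ.2, Real.pi_pos])).mp hc

theorem stretch_multiplier_zero_zero {K : ℝ} (hK : K ≠ 0) :
    2 * K / (1 + (K ^ 2 - 1) * Real.cos (0 - 0) ^ 2) = 2 / K := by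
  simp only [sub_zero, Real.cos_zero]
  field_simp
  ring

theorem isRepelling_zero_of_mul_cos_eq_one {K φ : ℝ} (hK : 2 < K)
    (hc : (K - 1) * Real.cos φ = 1) : IsRepelling K 0 φ := by
  have hK1 : 0 < K - 1 := by linarith
  have hcos : Real.cos φ = 1 / (K - 1) := by field_simp; linarith
  have hmul : 2 * K / (1 + (K ^ 2 - 1) * Real.cos (φ - 0) ^ 2) = K - 1 := by
    have hden : 1 + (K ^ 2 - 1) * Real.cos (φ - 0) ^ 2 = 2 * K / (K - 1) := by
      rw [sub_zero, hcos]
      field_simp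
      ring
    have hK0 : K ≠ 0 := by linarith
    rw [hden]
    field_simp
  unfold IsRepelling
  rw [hmul]
  linarith

/-- fixed angles of `H_{K,0}` for `K < 2`, `K = 2` and `K > 2`. -/
theorem fixed_angles_theta_zero (K : ℝ) (hK1 : 1 < K) :
    (K < 2 →
      IsFixedAngle K 0 0 ∧ IsRepelling K 0 0 ∧
        ∀ φ : ℝ, φ ∈ Set.Ioc (-π) π → IsFixedAngle K 0 φ → φ = 0) ∧
    (K = 2 →
      IsFixedAngle K 0 0 ∧ IsNeutral K 0 0 ∧
        ∀ φ : ℝ, φ ∈ Set.Ioc (-π) π → IsFixedAngle K 0 φ → φ = 0) ∧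
    (2 < K →
      ∃ φ₁ : ℝ, φ₁ ∈ Set.Ioo 0 (π / 2) ∧
        IsFixedAngle K 0 0 ∧ IsFixedAngle K 0 φ₁ ∧ IsFixedAngle K 0 (-φ₁) ∧
        IsAttracting K 0 0 ∧ IsRepelling K 0 φ₁ ∧ IsRepelling K 0 (-φ₁) ∧
        ∀ φ : ℝ, φ ∈ Set.Ioc (-π) π → IsFixedAngle K 0 φ →
          φ = 0 ∨ φ = φ₁ ∨ φ = -φ₁) := by
  have hK0 : 0 < K := by linarith
  have hzero : IsFixedAngle K 0 0 := (isFixedAngle_zero_iff_cos hK1 0).mpr (.inl Real.cos_zero)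
  have hunique (hK : K ≤ 2) (φ : ℝ) (hφ : φ ∈ Set.Ioc (-π) π) (hfix : IsFixedAngle K 0 φ) :
      φ = 0 := by
    refine eq_zero_of_cos_eq_one_of_mem_Ioc hφ ?_
    rcases (isFixedAngle_zero_iff_cos hK1 φ).mp hfix with hc | hc
    · exact hc
    · nlinarith [Real.cos_le_one φ]
  refine ⟨fun hK => ⟨hzero, ?_, hunique hK.le⟩, fun hK => ⟨hzero, ?_, hunique hK.le⟩, fun hK => ?_⟩
  · rw [IsRepelling, stretch_multiplier_zero_zero hK0.ne', lt_div_iff₀ hK0]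
    linarith
  · rw [IsNeutral, stretch_multiplier_zero_zero hK0.ne', hK]
    norm_num
  · have hpos : 0 < 1 / (K - 1) := one_div_pos.mpr (by linarith)
    have hlt : 1 / (K - 1) < 1 := by
      rw [div_lt_one (by linarith)]
      linarith
    have hcos : Real.cos (Real.arccos (1 / (K - 1))) = 1 / (K - 1) :=
      Real.cos_arccos (by linarith) hlt.le
    have hmul : (K - 1) * Real.cos (Real.arccos (1 / (K - 1))) = 1 := by
      rw [hcos]
      exact mul_one_div_cancel (by linarith)
    have hmul_neg : (K - 1) * Real.cos (-Real.arccos (1 / (K - 1))) = 1 := by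
      rwa [Real.cos_neg]
    refine ⟨Real.arccos (1 / (K - 1)),
      ⟨Real.arccos_pos.mpr hlt, Real.arccos_lt_pi_div_two.mpr hpos⟩, hzero,
      (isFixedAngle_zero_iff_cos hK1 _).mpr (.inr hmul),
      (isFixedAngle_zero_iff_cos hK1 _).mpr (.inr hmul_neg), ?_,
      isRepelling_zero_of_mul_cos_eq_one hK hmul,
      isRepelling_zero_of_mul_cos_eq_one hK hmul_neg, fun φ hφ hfix => ?_⟩
    · rwa [IsAttracting, stretch_multiplier_zero_zero hK0.ne', div_lt_one hK0]
    · rcases (isFixedAngle_zero_iff_cos hK1 φ).mp hfix with hc | hc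
      · exact .inl (eq_zero_of_cos_eq_one_of_mem_Ioc hφ hc)
      · have habs : Real.arccos (1 / (K - 1)) = |φ| := by
          rw [← Real.arccos_cos (abs_nonneg φ) (abs_le.mpr ⟨hφ.1.le, hφ.2⟩), Real.cos_abs,
            eq_one_div_of_mul_eq_one_right hc]
        rw [habs]
        exact .inr (eq_or_eq_neg_of_abs_eq rfl)
end

section
/- Let θ = π/2 and K > 1. Then the only fixed angle of H_{K,π/2} in (−π, π] is φ = 0, and the fixed ray R_0 is locally repelling; indeed the derivative quantity 2K/(1+(K²−1)cos²(0−π/2)) equals 2K > 1. -/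
open Real Complex Filter Topology

/-- For `θ = π / 2` the affine stretch fixes the real axis and dilates the imaginary axis by `K`. -/
theorem hK_pi_div_two_exp (K φ : ℝ) :
    hK K (π / 2) (Complex.exp ((φ : ℂ) * Complex.I)) = ⟨Real.cos φ, K * Real.sin φ⟩ := by
  have hexp : Complex.exp (2 * ((π / 2 : ℝ) : ℂ) * Complex.I) = -1 := by
    rw [← Complex.exp_pi_mul_I]
    push_cast
    ring_nf
  rw [hK, hexp]
  apply Complex.ext
  · simp [Complex.exp_ofReal_mul_I_re, Complex.exp_ofReal_mul_I_im]
    ring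
  · simp [Complex.exp_ofReal_mul_I_re, Complex.exp_ofReal_mul_I_im]
    ring

/-- The fixed angle equation for `θ = π / 2` in real coordinates. -/
theorem isFixedAngle_pi_div_two_iff (K φ : ℝ) :
    IsFixedAngle K (π / 2) φ ↔ ∃ t : ℝ, 0 < t ∧
      Real.cos φ ^ 2 - K ^ 2 * Real.sin φ ^ 2 = t * Real.cos φ ∧
      2 * K * Real.cos φ * Real.sin φ = t * Real.sin φ := by
  unfold IsFixedAngle HK
  refine exists_congr fun t => and_congr_right fun _ => ?_
  rw [hK_pi_div_two_exp, Complex.ext_iff, sq, Complex.mul_re, Complex.mul_im,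
    Complex.re_ofReal_mul, Complex.im_ofReal_mul, Complex.exp_ofReal_mul_I_re,
    Complex.exp_ofReal_mul_I_im]
  refine and_congr ?_ ?_ <;> constructor <;> intro h <;> linear_combination h

/-- for `θ = π/2`, the only fixed angle is `0` and it is repelling,
with derivative quantity equal to `2K > 1`. -/
theorem fixed_angle_theta_pi_div_two (K : ℝ) (hK1 : 1 < K) :
    IsFixedAngle K (π / 2) 0 ∧
    (∀ φ : ℝ, φ ∈ Set.Ioc (-π) π → IsFixedAngle K (π / 2) φ → φ = 0) ∧
    IsRepelling K (π / 2) 0 ∧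
    2 * K / (1 + (K ^ 2 - 1) * Real.cos (0 - π / 2) ^ 2) = 2 * K ∧
    1 < 2 * K := by
  have hderiv : 2 * K / (1 + (K ^ 2 - 1) * Real.cos (0 - π / 2) ^ 2) = 2 * K := by simp
  have hlt : 1 < 2 * K := by linarith
  refine ⟨?_, ?_, ?_, hderiv, hlt⟩
  · rw [isFixedAngle_pi_div_two_iff]
    exact ⟨1, one_pos, by simp, by simp⟩
  · rintro φ ⟨hφ₁, hφ₂⟩ hfix
    obtain ⟨t, ht, hre, him⟩ := (isFixedAngle_pi_div_two_iff K φ).mp hfix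
    have hsin : Real.sin φ = 0 := by
      by_contra hs
      have htc : 2 * K * Real.cos φ = t := mul_right_cancel₀ hs him
      rw [← htc] at hre
      have hpos : 0 < K ^ 2 * Real.sin φ ^ 2 := by positivity
      nlinarith [mul_nonneg (sub_nonneg.mpr hlt.le) (sq_nonneg (Real.cos φ))]
    rcases hφ₂.lt_or_eq with hlt' | rfl
    · exact (Real.sin_eq_zero_iff_of_lt_of_lt hφ₁ hlt').mp hsin
    · norm_num at hre
      linarith
  · rw [IsRepelling, hderiv]
    exact hlt
end

section
/- Let θ ∈ (0, π/2) and K > 1. Then there is exactly one fixed angle φ of H_{K,θ} lying in the interval (θ − π/2, 0), and its ray R_φ is locally repelling. -/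
open Real Complex Filter Topology

/-- The signed angle between `H_{K,θ}(e^{iφ})` and `e^{iφ}`. -/
noncomputable def angleDefect (K θ φ : ℝ) : ℝ :=
  φ + 2 * Real.arctan (-((K - 1) * Real.sin (φ - θ) * Real.cos (φ - θ)) /
    (1 + (K - 1) * Real.cos (φ - θ) ^ 2))

lemma one_add_mul_cos_sq_pos {K : ℝ} (hK1 : 1 < K) (x : ℝ) :
    0 < 1 + (K - 1) * Real.cos x ^ 2 := by
  have : 0 ≤ (K - 1) * Real.cos x ^ 2 := mul_nonneg (by linarith) (sq_nonneg _)
  linarith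

lemma one_add_sq_mul_cos_sq_pos {K : ℝ} (hK1 : 1 < K) (x : ℝ) :
    0 < 1 + (K ^ 2 - 1) * Real.cos x ^ 2 := by
  have : 0 ≤ (K ^ 2 - 1) * Real.cos x ^ 2 := mul_nonneg (by nlinarith) (sq_nonneg _)
  linarith

lemma hK_exp (K θ φ : ℝ) :
    hK K θ (Complex.exp (φ * Complex.I)) = Complex.exp (φ * Complex.I) *
      (((1 + (K - 1) * Real.cos (φ - θ) ^ 2 : ℝ) : ℂ) +
        ((-((K - 1) * Real.sin (φ - θ) * Real.cos (φ - θ)) : ℝ) : ℂ) * Complex.I) := by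
  have hconj : Complex.exp (2 * (θ : ℂ) * Complex.I) *
      (starRingEnd ℂ) (Complex.exp (φ * Complex.I)) =
      Complex.exp (φ * Complex.I) * Complex.exp (((-(φ - θ) : ℝ) : ℂ) * Complex.I) ^ 2 := by
    rw [← Complex.exp_conj, ← Complex.exp_nat_mul, ← Complex.exp_add, ← Complex.exp_add]
    congr 1
    simp only [map_mul, Complex.conj_ofReal, Complex.conj_I]
    push_cast
    ring
  have hpolar : Complex.exp (((-(φ - θ) : ℝ) : ℂ) * Complex.I) =
      (Real.cos (φ - θ) : ℂ) - (Real.sin (φ - θ) : ℂ) * Complex.I := by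
    rw [Complex.exp_mul_I, ← Complex.ofReal_cos, ← Complex.ofReal_sin, Real.cos_neg,
      Real.sin_neg]
    push_cast
    ring
  have hsq : (Real.sin (φ - θ) : ℂ) ^ 2 = 1 - (Real.cos (φ - θ) : ℂ) ^ 2 := by
    exact_mod_cast Real.sin_sq (φ - θ)
  rw [hpolar] at hconj
  unfold hK
  rw [mul_right_comm, hconj]
  generalize Real.sin (φ - θ) = s at *
  generalize Real.cos (φ - θ) = c at *
  push_cast
  linear_combination Complex.exp (φ * Complex.I) * ((K - 1) / 2) *
    ((s : ℂ) ^ 2 * Complex.I_sq - hsq)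

lemma exists_HK_exp {K : ℝ} (hK1 : 1 < K) (θ φ : ℝ) :
    ∃ r : ℝ, 0 < r ∧ HK K θ (Complex.exp (φ * Complex.I)) =
      r * Complex.exp (angleDefect K θ φ * Complex.I) * Complex.exp (φ * Complex.I) := by
  have hq := one_add_mul_cos_sq_pos hK1 (φ - θ)
  unfold HK angleDefect
  rw [hK_exp]
  generalize 1 + (K - 1) * Real.cos (φ - θ) ^ 2 = q at *
  generalize -((K - 1) * Real.sin (φ - θ) * Real.cos (φ - θ)) = p at *
  have hc := Real.cos_arctan_pos (p / q)
  have ht := Real.tan_arctan (p / q)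
  rw [Real.tan_eq_sin_div_cos] at ht
  generalize Real.arctan (p / q) = β at *
  have hp : q / Real.cos β * Real.sin β = p := by
    field_simp at ht ⊢
    linarith
  have hq' : q / Real.cos β * Real.cos β = q := by field_simp
  refine ⟨(q / Real.cos β) ^ 2, by positivity, ?_⟩
  have hpolar : (q : ℂ) + p * Complex.I =
      ((q / Real.cos β : ℝ) : ℂ) * Complex.exp (β * Complex.I) := by
    rw [Complex.exp_mul_I, ← Complex.ofReal_cos, ← Complex.ofReal_sin, mul_add, ← mul_assoc,
      ← Complex.ofReal_mul, ← Complex.ofReal_mul, hp, hq']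
  have hexp : Complex.exp (((φ + 2 * β : ℝ) : ℂ) * Complex.I) =
      Complex.exp (φ * Complex.I) * Complex.exp (β * Complex.I) ^ 2 := by
    rw [← Complex.exp_nat_mul, ← Complex.exp_add]
    congr 1
    push_cast
    ring
  rw [hpolar, hexp, Complex.ofReal_pow]
  ring

lemma isFixedAngle_of_angleDefect_eq_zero {K θ φ : ℝ} (hK1 : 1 < K)
    (h : angleDefect K θ φ = 0) : IsFixedAngle K θ φ := by
  obtain ⟨r, hr, hH⟩ := exists_HK_exp hK1 θ φ
  exact ⟨r, hr, by simpa [h] using hH⟩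

lemma IsFixedAngle.sin_angleDefect_eq_zero {K θ φ : ℝ} (hK1 : 1 < K)
    (h : IsFixedAngle K θ φ) : Real.sin (angleDefect K θ φ) = 0 := by
  obtain ⟨r, hr, hH⟩ := exists_HK_exp hK1 θ φ
  obtain ⟨t, -, hT⟩ := h
  have heq := mul_right_cancel₀ (Complex.exp_ne_zero _) (hH.symm.trans hT)
  have him := congrArg Complex.im heq
  rw [Complex.im_ofReal_mul, Complex.exp_ofReal_mul_I_im, Complex.ofReal_im] at him
  exact (mul_eq_zero.mp him).resolve_left hr.ne'

lemma IsFixedAngle.angleDefect_eq_zero {K θ φ : ℝ} (hK1 : 1 < K) (hθ : 0 < θ)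
    (hφ : φ ∈ Set.Ioo (θ - π / 2) 0) (h : IsFixedAngle K θ φ) : angleDefect K θ φ = 0 := by
  have hc : 0 < Real.cos (φ - θ) :=
    Real.cos_pos_of_mem_Ioo ⟨by linarith [hφ.1], by linarith [hφ.2, Real.pi_pos]⟩
  have hs : Real.sin (φ - θ) < 0 :=
    Real.sin_neg_of_neg_of_neg_pi_lt (by linarith [hφ.2]) (by linarith [hφ.1, Real.pi_pos])
  refine (Real.sin_eq_zero_iff_of_lt_of_lt ?_ ?_).mp (h.sin_angleDefect_eq_zero hK1)
  · have hβ : 0 ≤ Real.arctan (-((K - 1) * Real.sin (φ - θ) * Real.cos (φ - θ)) /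
        (1 + (K - 1) * Real.cos (φ - θ) ^ 2)) := by
      refine Real.arctan_nonneg.mpr (div_nonneg ?_ (one_add_mul_cos_sq_pos hK1 _).le)
      nlinarith [mul_pos (mul_pos (sub_pos.mpr hK1) (neg_pos.mpr hs)) hc]
    unfold angleDefect
    linarith [hφ.1, Real.pi_pos]
  · unfold angleDefect
    linarith [hφ.2, Real.arctan_lt_pi_div_two (-((K - 1) * Real.sin (φ - θ) *
      Real.cos (φ - θ)) / (1 + (K - 1) * Real.cos (φ - θ) ^ 2))]

lemma hasDerivAt_angleDefect {K : ℝ} (hK1 : 1 < K) (θ φ : ℝ) :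
    HasDerivAt (angleDefect K θ)
      (2 * K / (1 + (K ^ 2 - 1) * Real.cos (φ - θ) ^ 2) - 1) φ := by
  have hx : HasDerivAt (fun y : ℝ => y - θ) 1 φ := (hasDerivAt_id φ).sub_const θ
  have hq := one_add_mul_cos_sq_pos hK1 (φ - θ)
  have hQ := one_add_sq_mul_cos_sq_pos hK1 (φ - θ)
  have hp' := ((hx.sin.const_mul (K - 1)).mul hx.cos).neg
  have hq' := ((hx.cos.pow 2).const_mul (K - 1)).const_add 1
  refine ((hasDerivAt_id φ).add (((hp'.div hq' hq.ne').arctan).const_mul 2)).congr_deriv ?_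
  have hs := Real.sin_sq (φ - θ)
  simp only [Pi.neg_apply, Pi.mul_apply, Pi.pow_apply, Pi.div_apply]
  generalize Real.sin (φ - θ) = s at *
  generalize Real.cos (φ - θ) = c at *
  have hsum : 1 + (-((K - 1) * s * c) / (1 + (K - 1) * c ^ 2)) ^ 2 =
      (1 + (K ^ 2 - 1) * c ^ 2) / (1 + (K - 1) * c ^ 2) ^ 2 := by
    field_simp
    linear_combination (K - 1) ^ 2 * c ^ 2 * hs
  have hnum : -((K - 1) * (c * 1) * c + (K - 1) * s * (-s * 1)) * (1 + (K - 1) * c ^ 2) -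
      -((K - 1) * s * c) * ((K - 1) * (((2 : ℕ) : ℝ) * c ^ (2 - 1) * (-s * 1))) =
      K - (1 + (K ^ 2 - 1) * c ^ 2) := by
    norm_num
    linear_combination (K - 1) * (1 - (K - 1) * c ^ 2) * hs
  rw [hsum, hnum]
  clear hp' hq' hsum hnum
  generalize 1 + (K - 1) * c ^ 2 = q at *
  generalize 1 + (K ^ 2 - 1) * c ^ 2 = Q at *
  field_simp
  ring

lemma strictConcaveOn_angleDefect {K : ℝ} (hK1 : 1 < K) {θ : ℝ} (hθ : 0 < θ) :
    StrictConcaveOn ℝ (Set.Icc (θ - π / 2) 0) (angleDefect K θ) := by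
  refine StrictAntiOn.strictConcaveOn_of_deriv (convex_Icc _ _)
    (fun x _ => (hasDerivAt_angleDefect hK1 θ x).continuousAt.continuousWithinAt) ?_
  rw [interior_Icc]
  intro x hx y hy hxy
  rw [(hasDerivAt_angleDefect hK1 θ x).deriv, (hasDerivAt_angleDefect hK1 θ y).deriv]
  have hc : 0 < Real.cos (x - θ) :=
    Real.cos_pos_of_mem_Ioo ⟨by linarith [hx.1], by linarith [hx.2, Real.pi_pos]⟩
  have hlt : Real.cos (x - θ) < Real.cos (y - θ) := by
    rw [← Real.cos_neg (x - θ), ← Real.cos_neg (y - θ)]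
    exact Real.cos_lt_cos_of_nonneg_of_le_pi_div_two (by linarith [hy.2]) (by linarith [hx.1])
      (by linarith)
  have hK2 : 0 < K ^ 2 - 1 := by nlinarith
  have hx0 := one_add_sq_mul_cos_sq_pos hK1 (x - θ)
  gcongr

/-- there is exactly one fixed angle in `(θ − π/2, 0)`, and it is repelling. -/
theorem unique_repelling_fixed_angle_in_Fminus (K θ : ℝ) (hK1 : 1 < K)
    (hθ : θ ∈ Set.Ioo 0 (π / 2)) :
    ∃ φ : ℝ, φ ∈ Set.Ioo (θ - π / 2) 0 ∧ IsFixedAngle K θ φ ∧ IsRepelling K θ φ ∧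
      ∀ ψ : ℝ, ψ ∈ Set.Ioo (θ - π / 2) 0 → IsFixedAngle K θ ψ → ψ = φ := by
  have hK0 : 0 < K - 1 := sub_pos.mpr hK1
  have hcont : Continuous (angleDefect K θ) := continuous_iff_continuousAt.mpr fun x =>
    (hasDerivAt_angleDefect hK1 θ x).continuousAt
  have hconc := strictConcaveOn_angleDefect hK1 hθ.1
  have hleft : angleDefect K θ (θ - π / 2) < 0 := by
    have hx : θ - π / 2 - θ = -(π / 2) := by ring
    simp [angleDefect, hx, hθ.2]
  have hright : 0 < angleDefect K θ 0 := by
    have hc : 0 < Real.cos θ := Real.cos_pos_of_mem_Ioo ⟨by linarith [hθ.1, Real.pi_pos], hθ.2⟩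
    have hs : 0 < Real.sin θ := Real.sin_pos_of_pos_of_lt_pi hθ.1 (by linarith [hθ.1, hθ.2])
    have hq := one_add_mul_cos_sq_pos hK1 θ
    have : 0 < Real.arctan ((K - 1) * Real.sin θ * Real.cos θ /
        (1 + (K - 1) * Real.cos θ ^ 2)) := Real.arctan_pos.mpr (by positivity)
    simpa [angleDefect] using this
  have h0 : (0 : ℝ) ∈ Set.Icc (θ - π / 2) 0 := ⟨by linarith [hθ.2], le_rfl⟩
  have hnot : ∀ a b : ℝ, a ∈ Set.Ioo (θ - π / 2) 0 → b ∈ Set.Ioo (θ - π / 2) 0 →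
      angleDefect K θ a = 0 → angleDefect K θ b = 0 → ¬ a < b := by
    intro a b ha hb hGa hGb hab
    have := hconc.slope_anti_adjacent (Set.Ioo_subset_Icc_self ha) h0 hab hb.2
    rw [hGa, hGb, sub_zero, sub_zero, zero_div] at this
    exact absurd this (not_lt.mpr (div_nonneg hright.le (by linarith [hb.2])))
  obtain ⟨φ, hφ, hG⟩ := intermediate_value_Ioo h0.1 hcont.continuousOn
    (show (0 : ℝ) ∈ Set.Ioo _ _ from ⟨hleft, hright⟩)
  refine ⟨φ, hφ, isFixedAngle_of_angleDefect_eq_zero hK1 hG, ?_, fun ψ hψ h => ?_⟩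
  · have hslope := hconc.concaveOn.slope_le_of_hasDerivAt (Set.Ioo_subset_Icc_self hφ) h0 hφ.2
      (hasDerivAt_angleDefect hK1 θ φ)
    have hpos : 0 < slope (angleDefect K θ) φ 0 := by
      rw [slope_def_field, hG, sub_zero]
      exact div_pos hright (by linarith [hφ.2])
    unfold IsRepelling
    linarith
  · have hψ0 := h.angleDefect_eq_zero hK1 hθ.1 hψ
    exact le_antisymm (not_lt.mp (hnot φ ψ hφ hψ hG hψ0)) (not_lt.mp (hnot ψ φ hψ hφ hψ0 hG))
end

section
/- Let θ ∈ (0, π/2). Then there exists exactly one K > 1 such that H_{K,θ} has a neutral fixed ray, i.e. a fixed angle φ with 2K = 1 + (K²−1)cos²(φ−θ); moreover this unique value, denoted K_θ, satisfies K_θ > 2. -/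
open Real Complex Filter Topology

theorem HK_exp (K θ ψ : ℝ) :
    HK K θ (Complex.exp (((θ + ψ : ℝ) : ℂ) * Complex.I)) =
      (Complex.exp (θ * Complex.I) * ((K * Real.cos ψ : ℝ) + (Real.sin ψ : ℝ) * Complex.I)) ^ 2 := by
  have hP : Complex.exp (ψ * Complex.I) = Complex.cos ψ + Complex.sin ψ * Complex.I :=
    Complex.exp_mul_I _
  have hPn : Complex.exp (-(ψ * Complex.I)) = Complex.cos ψ - Complex.sin ψ * Complex.I := by
    rw [← neg_mul, Complex.exp_mul_I, Complex.cos_neg, Complex.sin_neg]; ring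
  have h_exp : Complex.exp (((θ + ψ : ℝ) : ℂ) * Complex.I) =
      Complex.exp (θ * Complex.I) * Complex.exp (ψ * Complex.I) := by
    rw [← Complex.exp_add]; push_cast; ring_nf
  have h_conj : Complex.exp (2 * (θ : ℂ) * Complex.I) *
      (starRingEnd ℂ) (Complex.exp (((θ + ψ : ℝ) : ℂ) * Complex.I)) =
      Complex.exp (θ * Complex.I) * Complex.exp (-(ψ * Complex.I)) := by
    rw [← Complex.exp_conj, ← Complex.exp_add, ← Complex.exp_add, map_mul, Complex.conj_I,
      Complex.conj_ofReal]
    push_cast; ring_nf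
  unfold HK hK
  rw [mul_right_comm (Complex.exp _), h_conj, h_exp, hP, hPn]
  push_cast
  ring

theorem isFixedAngle_add_iff (K θ ψ : ℝ) :
    IsFixedAngle K θ (θ + ψ) ↔ ∃ t : ℝ, 0 < t ∧
      Real.cos ψ * (K ^ 2 * Real.cos ψ ^ 2 + (2 * K - 1) * Real.sin ψ ^ 2) = t * Real.cos θ ∧
      Real.sin ψ * ((K ^ 2 - 2 * K) * Real.cos ψ ^ 2 - Real.sin ψ ^ 2) = t * Real.sin θ := by
  unfold IsFixedAngle
  refine exists_congr fun t => and_congr_right fun _ => ?_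
  have h_exp : Complex.exp (((θ + ψ : ℝ) : ℂ) * Complex.I) =
      Complex.exp (θ * Complex.I) * Complex.exp (ψ * Complex.I) := by
    rw [← Complex.exp_add]; push_cast; ring_nf
  rw [HK_exp, h_exp, mul_pow, sq (Complex.exp _), mul_assoc, mul_left_comm (t : ℂ),
    mul_right_inj' (Complex.exp_ne_zero _), Complex.exp_mul_I, Complex.exp_mul_I,
    ← Complex.ofReal_cos, ← Complex.ofReal_sin, ← Complex.ofReal_cos, ← Complex.ofReal_sin,
    Complex.ext_iff]
  simp only [sq, Complex.mul_re, Complex.mul_im, Complex.add_re, Complex.add_im,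
    Complex.ofReal_re, Complex.ofReal_im, Complex.I_re, Complex.I_im]
  have hθ := Real.sin_sq_add_cos_sq θ
  have hψ := Real.sin_sq_add_cos_sq ψ
  generalize Real.cos θ = a at *
  generalize Real.sin θ = b at *
  generalize Real.cos ψ = c at *
  generalize Real.sin ψ = s at *
  constructor
  · rintro ⟨h1, h2⟩
    constructor
    · linear_combination (a * c - b * s) * h1 + (b * c + a * s) * h2 + t * a * hψ -
        (c * (K ^ 2 * c ^ 2 + (2 * K - 1) * s ^ 2)) * hθ
    · linear_combination (b * c + a * s) * h1 - (a * c - b * s) * h2 + t * b * hψ -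
        (s * ((K ^ 2 - 2 * K) * c ^ 2 - s ^ 2)) * hθ
  · rintro ⟨h1, h2⟩
    constructor
    · linear_combination (a * c - b * s) * h1 + (b * c + a * s) * h2 + t * c * hθ -
        (a * (K ^ 2 * c ^ 2 - s ^ 2) - b * (2 * K * c * s)) * hψ
    · linear_combination (b * c + a * s) * h1 - (a * c - b * s) * h2 + t * s * hθ -
        (b * (K ^ 2 * c ^ 2 - s ^ 2) + a * (2 * K * c * s)) * hψ

theorem isNeutral_add_iff {K θ ψ : ℝ} (hK : 1 < K) :
    IsNeutral K θ (θ + ψ) ↔ (K ^ 2 - 1) * Real.cos ψ ^ 2 = 2 * K - 1 := by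
  have hD : 0 < 1 + (K ^ 2 - 1) * Real.cos ψ ^ 2 := by
    have : 0 ≤ (K ^ 2 - 1) * Real.cos ψ ^ 2 := mul_nonneg (by nlinarith) (sq_nonneg _)
    linarith
  unfold IsNeutral
  rw [add_sub_cancel_left, div_eq_one_iff_eq hD.ne']
  constructor <;> intro h <;> linarith

theorem sin_sq_mul_eq_of_neutral_fixed {K θ ψ : ℝ} (hK : 1 < K)
    (hf : IsFixedAngle K θ (θ + ψ)) (hn : IsNeutral K θ (θ + ψ)) :
    Real.sin θ ^ 2 * (2 * K - 1) ^ 3 = Real.cos θ ^ 2 * (K * (K - 2) ^ 3) := by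
  rw [isNeutral_add_iff hK] at hn
  obtain ⟨t, ht, h1, h2⟩ := (isFixedAngle_add_iff K θ ψ).1 hf
  have hψ := Real.sin_sq_add_cos_sq ψ
  have hs : (K ^ 2 - 1) * Real.sin ψ ^ 2 = K * (K - 2) := by
    linear_combination (K ^ 2 - 1) * hψ - hn
  have h1' : (K + 1) * (t * Real.cos θ) = 2 * K * (2 * K - 1) * Real.cos ψ := by
    have : (K - 1) ≠ 0 := by linarith
    apply mul_left_cancel₀ this
    linear_combination (1 - K ^ 2) * h1 + Real.cos ψ * (K ^ 2 * hn + (2 * K - 1) * hs)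
  have h2' : (K + 1) * (t * Real.sin θ) = 2 * K * (K - 2) * Real.sin ψ := by
    have : (K - 1) ≠ 0 := by linarith
    apply mul_left_cancel₀ this
    linear_combination (1 - K ^ 2) * h2 + Real.sin ψ * ((K ^ 2 - 2 * K) * hn - hs)
  have h3 : Real.sin θ * ((2 * K - 1) * Real.cos ψ) = Real.cos θ * ((K - 2) * Real.sin ψ) := by
    have : (K + 1) * t * (2 * K) ≠ 0 := by positivity
    apply mul_left_cancel₀ this
    linear_combination (2 * K * (2 * K - 1) * Real.cos ψ) * h2' -
      (2 * K * (K - 2) * Real.sin ψ) * h1'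
  linear_combination (K ^ 2 - 1) * (Real.sin θ * ((2 * K - 1) * Real.cos ψ) +
      Real.cos θ * ((K - 2) * Real.sin ψ)) * h3 -
    Real.sin θ ^ 2 * (2 * K - 1) ^ 2 * hn + Real.cos θ ^ 2 * (K - 2) ^ 2 * hs

theorem exists_neutral_fixed {K θ : ℝ} (hθ : θ ∈ Set.Ioo 0 (π / 2)) (hK : 2 < K)
    (h : Real.sin θ ^ 2 * (2 * K - 1) ^ 3 = Real.cos θ ^ 2 * (K * (K - 2) ^ 3)) :
    ∃ φ : ℝ, φ ∈ Set.Ioc (-π) π ∧ IsFixedAngle K θ φ ∧ IsNeutral K θ φ := by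
  obtain ⟨hθ0, hθ1⟩ := hθ
  have hsin : 0 < Real.sin θ := Real.sin_pos_of_pos_of_lt_pi hθ0 (by linarith [Real.pi_pos])
  have hcos : 0 < Real.cos θ := Real.cos_pos_of_mem_Ioo ⟨by linarith, hθ1⟩
  have hD : 0 < K ^ 2 - 1 := by nlinarith
  have hN : 0 < 2 * K - 1 := by linarith
  have hK2 : 0 < K - 2 := by linarith
  set c := √((2 * K - 1) / (K ^ 2 - 1)) with hc
  have hc0 : 0 < c := Real.sqrt_pos.2 (by positivity)
  have hc2 : (K ^ 2 - 1) * c ^ 2 = 2 * K - 1 := by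
    rw [hc, Real.sq_sqrt (by positivity), mul_div_cancel₀ _ hD.ne']
  have hc1 : c ≤ 1 := by
    rw [hc, Real.sqrt_le_left zero_le_one, one_pow, div_le_one hD]
    nlinarith
  set ψ := Real.arccos c with hψ
  have hcψ : Real.cos ψ = c := Real.cos_arccos (by linarith) hc1
  have hψ0 : 0 ≤ ψ := Real.arccos_nonneg c
  have hψ1 : ψ ≤ π / 2 := Real.arccos_le_pi_div_two.2 hc0.le
  have hsψ : 0 ≤ Real.sin ψ := Real.sin_nonneg_of_nonneg_of_le_pi hψ0 (by linarith)
  have hn : (K ^ 2 - 1) * Real.cos ψ ^ 2 = 2 * K - 1 := by rw [hcψ, hc2]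
  have hs : (K ^ 2 - 1) * Real.sin ψ ^ 2 = K * (K - 2) := by
    linear_combination (K ^ 2 - 1) * Real.sin_sq_add_cos_sq ψ - hn
  rw [← hcψ] at hc0
  have h3 : Real.sin θ * ((2 * K - 1) * Real.cos ψ) = Real.cos θ * ((K - 2) * Real.sin ψ) := by
    rw [← sq_eq_sq₀ (by positivity) (by positivity)]
    apply mul_left_cancel₀ hD.ne'
    linear_combination h + Real.sin θ ^ 2 * (2 * K - 1) ^ 2 * hn -
      Real.cos θ ^ 2 * (K - 2) ^ 2 * hs
  refine ⟨θ + ψ, ⟨by linarith, by linarith⟩, (isFixedAngle_add_iff K θ ψ).2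
    ⟨2 * K * (2 * K - 1) * Real.cos ψ / ((K + 1) * Real.cos θ), by positivity, ?_, ?_⟩,
    (isNeutral_add_iff (by linarith)).2 hn⟩
  · field_simp
    apply mul_left_cancel₀ hD.ne'
    linear_combination (K + 1) * (K ^ 2 * hn + (2 * K - 1) * hs)
  · field_simp
    apply mul_left_cancel₀ hD.ne'
    linear_combination (K + 1) * Real.cos θ * Real.sin ψ * ((K ^ 2 - 2 * K) * hn - hs) -
      (K ^ 2 - 1) * 2 * K * h3

theorem exists_two_lt_sin_sq_mul_eq {θ : ℝ} (hθ : θ ∈ Set.Ioo 0 (π / 2)) :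
    ∃ K : ℝ, 2 < K ∧
      Real.sin θ ^ 2 * (2 * K - 1) ^ 3 = Real.cos θ ^ 2 * (K * (K - 2) ^ 3) := by
  obtain ⟨hθ0, hθ1⟩ := hθ
  have hsin : 0 < Real.sin θ := Real.sin_pos_of_pos_of_lt_pi hθ0 (by linarith [Real.pi_pos])
  have hcos : 0 < Real.cos θ := Real.cos_pos_of_mem_Ioo ⟨by linarith, hθ1⟩
  set T := Real.sin θ ^ 2 / Real.cos θ ^ 2 with hT
  have hT0 : 0 < T := by positivity
  have hTs : Real.sin θ ^ 2 = T * Real.cos θ ^ 2 := by rw [hT]; field_simp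
  set f : ℝ → ℝ := fun K => K * (K - 2) ^ 3 - T * (2 * K - 1) ^ 3 with hf
  have hfc : ContinuousOn f (Set.Icc 2 (3 + 125 * T)) := by fun_prop
  have hfb : 0 ≤ f (3 + 125 * T) := by
    have h1 : (2 * (3 + 125 * T) - 1) ^ 3 ≤ (5 * (1 + 125 * T)) ^ 3 :=
      pow_le_pow_left₀ (by linarith) (by linarith) 3
    have h2 := mul_le_mul_of_nonneg_left h1 hT0.le
    have h3 : 0 < (1 + 125 * T) ^ 3 := by positivity
    simp only [hf]
    nlinarith
  have hfa : f 2 < 0 := by simp only [hf]; nlinarith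
  obtain ⟨K, ⟨hK, -⟩, hK0⟩ := intermediate_value_Icc (by linarith) hfc ⟨hfa.le, hfb⟩
  refine ⟨K, lt_of_le_of_ne hK ?_, ?_⟩
  · rintro rfl
    linarith
  · simp only [hf] at hK0
    linear_combination (2 * K - 1) ^ 3 * hTs - Real.cos θ ^ 2 * hK0

theorem mul_sub_two_cube_lt {K L : ℝ} (hK : 2 < K) (hKL : K < L) :
    K * (K - 2) ^ 3 * (2 * L - 1) ^ 3 < L * (L - 2) ^ 3 * (2 * K - 1) ^ 3 := by
  have h0 : 0 ≤ (K - 2) * (2 * L - 1) := mul_nonneg (by linarith) (by linarith)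
  have h1 : (K - 2) * (2 * L - 1) < (L - 2) * (2 * K - 1) := by nlinarith
  have h2 := pow_lt_pow_left₀ h1 h0 three_ne_zero
  have h3 := mul_lt_mul'' hKL h2 (by linarith) (by positivity)
  linarith [h3, mul_pow (K - 2) (2 * L - 1) 3, mul_pow (L - 2) (2 * K - 1) 3]

/-- there is exactly one `K > 1` with a neutral fixed ray, and it exceeds 2. -/
theorem unique_K_with_neutral_fixed_ray (θ : ℝ) (hθ : θ ∈ Set.Ioo 0 (π / 2)) :
    ∃ Kθ : ℝ, 1 < Kθ ∧ 2 < Kθ ∧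
      (∃ φ : ℝ, φ ∈ Set.Ioc (-π) π ∧ IsFixedAngle Kθ θ φ ∧ IsNeutral Kθ θ φ) ∧
      ∀ K : ℝ, 1 < K →
        (∃ φ : ℝ, φ ∈ Set.Ioc (-π) π ∧ IsFixedAngle K θ φ ∧ IsNeutral K θ φ) →
        K = Kθ := by
  obtain ⟨L, hL, hLθ⟩ := exists_two_lt_sin_sq_mul_eq hθ
  refine ⟨L, by linarith, hL, exists_neutral_fixed hθ hL hLθ, ?_⟩
  rintro K hK ⟨φ, -, hf, hn⟩
  obtain ⟨ψ, rfl⟩ : ∃ ψ, φ = θ + ψ := ⟨φ - θ, by ring⟩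
  have hKθ := sin_sq_mul_eq_of_neutral_fixed hK hf hn
  have hsin : 0 < Real.sin θ :=
    Real.sin_pos_of_pos_of_lt_pi hθ.1 (by linarith [hθ.2, Real.pi_pos])
  have hcos : 0 < Real.cos θ := Real.cos_pos_of_mem_Ioo ⟨by linarith [hθ.1, Real.pi_pos], hθ.2⟩
  have hK2 : 2 < K := by
    have h1 : 0 < Real.cos θ ^ 2 * (K * (K - 2) ^ 3) := by
      rw [← hKθ]
      have : 0 < 2 * K - 1 := by linarith
      positivity
    have h2 := pos_of_mul_pos_right h1 (by positivity)
    have h3 := pos_of_mul_pos_right h2 (by linarith)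
    have h4 := (Odd.pow_pos_iff (by decide : Odd 3)).1 h3
    linarith
  have h_eq : K * (K - 2) ^ 3 * (2 * L - 1) ^ 3 = L * (L - 2) ^ 3 * (2 * K - 1) ^ 3 := by
    have : Real.cos θ ^ 2 ≠ 0 := by positivity
    apply mul_left_cancel₀ this
    linear_combination (2 * K - 1) ^ 3 * hLθ - (2 * L - 1) ^ 3 * hKθ
  rcases lt_trichotomy K L with h | h | h
  · exact absurd h_eq (mul_sub_two_cube_lt hK2 h).ne
  · exact h
  · exact absurd h_eq (mul_sub_two_cube_lt hL h).ne'
end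

section
/- Let θ ∈ (0, π/2), let K_θ be the unique K > 1 for which H_{K,θ} has a neutral fixed ray, and suppose 1 < K < K_θ. Then H_{K,θ} has exactly one fixed angle in (−π, π]; this angle lies in the interval (θ − π/2, 0), and its ray is locally repelling. -/
open Real Complex Filter Topology

/-- The cubic in `T = tan (φ - θ)`, with `τ = tan θ`, whose roots give the fixed angles. -/
def fixedCubic (K τ T : ℝ) : ℝ :=
  T ^ 3 + (2 * K - 1) * τ * T ^ 2 + (2 * K - K ^ 2) * T + τ * K ^ 2

lemma HK_exp_eq_iff (K θ α t : ℝ) :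
    HK K θ (Complex.exp (((θ + α : ℝ) : ℂ) * Complex.I)) =
        (t : ℂ) * Complex.exp (((θ + α : ℝ) : ℂ) * Complex.I) ↔
      (K ^ 2 * Real.cos α ^ 2 - Real.sin α ^ 2) * Real.cos θ
          - 2 * K * Real.cos α * Real.sin α * Real.sin θ = t * Real.cos α ∧
        (K ^ 2 * Real.cos α ^ 2 - Real.sin α ^ 2) * Real.sin θ
          + 2 * K * Real.cos α * Real.sin α * Real.cos θ = t * Real.sin α := by
  have hθ : Complex.exp (θ * Complex.I) = (⟨Real.cos θ, Real.sin θ⟩ : ℂ) := by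
    apply Complex.ext <;> simp [Complex.exp_ofReal_mul_I_re, Complex.exp_ofReal_mul_I_im]
  have hα : Complex.exp (α * Complex.I) = (⟨Real.cos α, Real.sin α⟩ : ℂ) := by
    apply Complex.ext <;> simp [Complex.exp_ofReal_mul_I_re, Complex.exp_ofReal_mul_I_im]
  have hsum : Complex.exp (((θ + α : ℝ) : ℂ) * Complex.I) =
      Complex.exp (θ * Complex.I) * Complex.exp (α * Complex.I) := by
    rw [← Complex.exp_add]; push_cast; ring_nf
  have htwo : Complex.exp (2 * (θ : ℂ) * Complex.I) =
      Complex.exp (θ * Complex.I) * Complex.exp (θ * Complex.I) := by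
    rw [← Complex.exp_add]; ring_nf
  have hunit : Complex.exp (θ * Complex.I) * (starRingEnd ℂ) (Complex.exp (θ * Complex.I)) = 1 := by
    rw [hθ]
    apply Complex.ext
    · simp; nlinarith [Real.sin_sq_add_cos_sq θ]
    · simp; ring
  have hstretch : hK K θ (Complex.exp (((θ + α : ℝ) : ℂ) * Complex.I)) =
      Complex.exp (θ * Complex.I) * (⟨K * Real.cos α, Real.sin α⟩ : ℂ) := by
    have hsplit : (⟨K * Real.cos α, Real.sin α⟩ : ℂ) =
        (((K + 1) / 2 : ℝ) : ℂ) * Complex.exp (α * Complex.I) +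
          (((K - 1) / 2 : ℝ) : ℂ) * (starRingEnd ℂ) (Complex.exp (α * Complex.I)) := by
      rw [hα]
      apply Complex.ext <;>
        simp only [Complex.add_re, Complex.add_im, Complex.re_ofReal_mul, Complex.im_ofReal_mul,
          Complex.conj_re, Complex.conj_im] <;> ring
    rw [hsplit, hK, hsum, htwo, map_mul]
    linear_combination Complex.exp (θ * Complex.I) * (((K - 1) / 2 : ℝ) : ℂ) *
      (starRingEnd ℂ) (Complex.exp (α * Complex.I)) * hunit
  have hcancel : HK K θ (Complex.exp (((θ + α : ℝ) : ℂ) * Complex.I)) =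
        (t : ℂ) * Complex.exp (((θ + α : ℝ) : ℂ) * Complex.I) ↔
      (⟨K * Real.cos α, Real.sin α⟩ : ℂ) ^ 2 * ⟨Real.cos θ, Real.sin θ⟩ =
        (t : ℂ) * ⟨Real.cos α, Real.sin α⟩ := by
    rw [HK, hstretch, hsum, ← hθ, ← hα]
    constructor <;> intro h
    · apply mul_left_cancel₀ (Complex.exp_ne_zero (θ * Complex.I))
      linear_combination h
    · linear_combination Complex.exp (θ * Complex.I) * h
  rw [hcancel, Complex.ext_iff]
  simp only [pow_two, Complex.mul_re, Complex.mul_im, Complex.ofReal_re, Complex.ofReal_im]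
  constructor <;> rintro ⟨h₁, h₂⟩ <;> constructor <;> first
    | linear_combination h₁
    | linear_combination h₂

lemma isFixedAngle_iff_s13 {K θ φ : ℝ} (hK : 1 < K) (hθ : 0 < Real.cos θ) :
    IsFixedAngle K θ φ ↔
      0 < Real.cos (φ - θ) ∧ fixedCubic K (Real.tan θ) (Real.tan (φ - θ)) = 0 := by
  obtain ⟨α, rfl⟩ : ∃ α, φ = θ + α := ⟨φ - θ, by ring⟩
  rw [add_sub_cancel_left, IsFixedAngle]
  simp only [HK_exp_eq_iff]
  have hα1 := Real.sin_sq_add_cos_sq α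
  have hθ1 := Real.sin_sq_add_cos_sq θ
  have hF : 0 < Real.cos α → Real.cos θ * Real.cos α ^ 3 *
      fixedCubic K (Real.tan θ) (Real.tan α) =
      Real.sin θ * Real.cos α * (K ^ 2 * Real.cos α ^ 2 + (2 * K - 1) * Real.sin α ^ 2) +
      Real.cos θ * Real.sin α * (Real.sin α ^ 2 + (2 * K - K ^ 2) * Real.cos α ^ 2) := by
    intro hc
    rw [fixedCubic, Real.tan_eq_sin_div_cos, Real.tan_eq_sin_div_cos]
    field_simp
    ring
  set c := Real.cos α
  set s := Real.sin α
  set C := Real.cos θ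
  set S := Real.sin θ
  have hA : 0 < K ^ 2 * c ^ 2 + (2 * K - 1) * s ^ 2 := by
    nlinarith [mul_nonneg (sq_nonneg (K - 1)) (sq_nonneg c)]
  set A := K ^ 2 * c ^ 2 + (2 * K - 1) * s ^ 2 with hAdef
  set B := s ^ 2 + (2 * K - K ^ 2) * c ^ 2 with hBdef
  constructor
  · rintro ⟨t, ht, h₁, h₂⟩
    have him : S * c * A + C * s * B = 0 := by
      rw [hAdef, hBdef]; linear_combination c * h₂ - s * h₁
    have hre : C * c * A - S * s * B = t := by
      rw [hAdef, hBdef]; linear_combination c * h₁ + s * h₂ + t * hα1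
    have hct : C * t = c * A := by
      linear_combination -C * hre - S * him + (c * A) * hθ1
    have hc : 0 < c := pos_of_mul_pos_left (hct ▸ mul_pos hθ ht) hA.le
    refine ⟨hc, ?_⟩
    have h := hF hc
    rw [him] at h
    exact (mul_eq_zero.1 h).resolve_left (by positivity)
  · rintro ⟨hc, h⟩
    have him : S * c * A + C * s * B = 0 := by rw [← hF hc, h, mul_zero]
    refine ⟨C * c * A - S * s * B, ?_, ?_, ?_⟩
    · have hct : C * (C * c * A - S * s * B) = c * A := by
        linear_combination -S * him + (c * A) * hθ1
      exact pos_of_mul_pos_right (hct ▸ mul_pos hc hA) hθ.le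
    · rw [hAdef, hBdef] at *
      linear_combination -s * him - ((K ^ 2 * c ^ 2 - s ^ 2) * C - 2 * K * c * s * S) * hα1
    · rw [hAdef, hBdef] at *
      linear_combination c * him - ((K ^ 2 * c ^ 2 - s ^ 2) * S + 2 * K * c * s * C) * hα1

lemma one_add_tan_sq_mul_cos_sq {α : ℝ} (hc : 0 < Real.cos α) :
    (1 + Real.tan α ^ 2) * Real.cos α ^ 2 = 1 := by
  rw [Real.tan_eq_sin_div_cos]
  field_simp
  linarith [Real.sin_sq_add_cos_sq α]

lemma isRepelling_of_tan {K θ φ : ℝ} (hK : 1 < K) (hc : 0 < Real.cos (φ - θ))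
    (h : 0 < (2 * K - 1) * Real.tan (φ - θ) ^ 2 + 2 * K - K ^ 2) : IsRepelling K θ φ := by
  have hT := one_add_tan_sq_mul_cos_sq hc
  have hc2 : 0 < Real.cos (φ - θ) ^ 2 := by positivity
  rw [IsRepelling, one_lt_div (by nlinarith)]
  nlinarith

lemma IsNeutral.tan_eq {K θ φ : ℝ} (hK : 1 < K) (hc : 0 < Real.cos (φ - θ))
    (h : IsNeutral K θ φ) : (2 * K - 1) * Real.tan (φ - θ) ^ 2 + 2 * K - K ^ 2 = 0 := by
  have hT := one_add_tan_sq_mul_cos_sq hc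
  have hc2 : 0 < Real.cos (φ - θ) ^ 2 := by positivity
  have hpos : 0 < 1 + (K ^ 2 - 1) * Real.cos (φ - θ) ^ 2 := by nlinarith
  rw [IsNeutral, div_eq_one_iff_eq hpos.ne'] at h
  linear_combination (1 + Real.tan (φ - θ) ^ 2) * h + (K ^ 2 - 1) * hT

lemma sq_add_pos_of_fixedCubic_eq_zero {K τ T : ℝ} (hK : 1 < K) (hτ : 0 < τ) (hT : T < 0)
    (h : fixedCubic K τ T = 0) : 0 < T ^ 2 + 2 * K - K ^ 2 := by
  rw [fixedCubic] at h
  have hA : 0 < τ * (K ^ 2 + (2 * K - 1) * T ^ 2) := by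
    have : 0 < 2 * K - 1 := by linarith
    positivity
  have hB : (-T) * (T ^ 2 + 2 * K - K ^ 2) = τ * (K ^ 2 + (2 * K - 1) * T ^ 2) := by
    linear_combination -h
  exact pos_of_mul_pos_right (hB ▸ hA) (by linarith)

lemma multiplier_pos_of_fixedCubic_eq_zero {K τ T : ℝ} (hK : 1 < K) (hτ : 0 < τ) (hT : T < 0)
    (h : fixedCubic K τ T = 0) : 0 < (2 * K - 1) * T ^ 2 + 2 * K - K ^ 2 := by
  have := sq_add_pos_of_fixedCubic_eq_zero hK hτ hT h
  nlinarith [sq_nonneg T]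

lemma fixedCubic_neg_root_unique {K τ T₁ T₂ : ℝ} (hK : 1 < K) (hτ : 0 < τ)
    (hT₁ : T₁ < 0) (hT₂ : T₂ < 0) (h₁ : fixedCubic K τ T₁ = 0) (h₂ : fixedCubic K τ T₂ = 0) :
    T₁ = T₂ := by
  have hp₁ := sq_add_pos_of_fixedCubic_eq_zero hK hτ hT₁ h₁
  have hP : 0 < T₁ * T₂ := mul_pos_of_neg_of_neg hT₁ hT₂
  have hmul : (T₁ - T₂) * (K ^ 2 * (T₁ ^ 2 + T₁ * T₂ + T₂ ^ 2) + (2 * K - K ^ 2) * K ^ 2 +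
      (2 * K - 1) * (T₁ * T₂) ^ 2 - (2 * K - K ^ 2) * (2 * K - 1) * (T₁ * T₂)) = 0 := by
    rw [fixedCubic] at h₁ h₂
    linear_combination (K ^ 2 + (2 * K - 1) * T₂ ^ 2) * h₁ - (K ^ 2 + (2 * K - 1) * T₁ ^ 2) * h₂
  have hpos : 0 < K ^ 2 * (T₁ ^ 2 + T₁ * T₂ + T₂ ^ 2) + (2 * K - K ^ 2) * K ^ 2 +
      (2 * K - 1) * (T₁ * T₂) ^ 2 - (2 * K - K ^ 2) * (2 * K - 1) * (T₁ * T₂) := by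
    have he : 0 < 2 * K - 1 := by linarith
    have hsq : 0 < (2 * K - 1) * (T₁ * T₂) ^ 2 := by positivity
    rcases le_total K 2 with h | h
    · have hd : 0 ≤ (2 * K - K ^ 2) * K ^ 2 := mul_nonneg (by nlinarith) (sq_nonneg K)
      have h3 : 0 ≤ K ^ 2 * (T₁ - T₂) ^ 2 := by positivity
      have h4 : 0 < (2 * K * (K ^ 2 - K + 1)) * (T₁ * T₂) :=
        mul_pos (mul_pos (by linarith) (by nlinarith)) hP
      nlinarith
    · have hd : 0 ≤ (K ^ 2 - 2 * K) * (2 * K - 1) * (T₁ * T₂) :=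
        mul_nonneg (mul_nonneg (by nlinarith) he.le) hP.le
      have h3 : 0 < K ^ 2 * (T₁ ^ 2 + 2 * K - K ^ 2) := by positivity
      have h4 : 0 < K ^ 2 * (T₁ * T₂ + T₂ ^ 2) := by positivity
      nlinarith
  exact sub_eq_zero.1 ((mul_eq_zero.1 hmul).resolve_right hpos.ne')

lemma exists_fixedCubic_root_lt_neg {K τ : ℝ} (hK : 1 < K) (hτ : 0 < τ) :
    ∃ T < -τ, fixedCubic K τ T = 0 := by
  set M := 2 * K * τ + K ^ 2 with hM
  have hMτ : τ < M := by nlinarith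
  have hMK : K < M := by nlinarith [mul_pos (by linarith : 0 < K) hτ]
  have hcont : Continuous (fixedCubic K τ) := by unfold fixedCubic; fun_prop
  have hright : 0 < fixedCubic K τ (-τ) := by
    have : fixedCubic K τ (-τ) = 2 * (K - 1) * τ ^ 3 + 2 * K * (K - 1) * τ := by
      rw [fixedCubic]; ring
    rw [this]
    have : 0 < K - 1 := by linarith
    positivity
  have hleft : fixedCubic K τ (-M) < 0 := by
    have : fixedCubic K τ (-M) =
        -(K ^ 2 * (M * (M - 1)) + τ * ((M - K) * (M + K)) + 2 * K * M) := by
      rw [fixedCubic]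
      linear_combination (-M ^ 2) * hM
    rw [this]
    have h1 : 0 < M - 1 := by linarith
    have h2 : 0 < M - K := by linarith
    have h3 : 0 < M := by linarith
    have : 0 < K := by linarith
    rw [neg_lt_zero]
    positivity
  obtain ⟨T, hT, h⟩ := intermediate_value_Icc (neg_le_neg hMτ.le) hcont.continuousOn
    ⟨hleft.le, hright.le⟩
  exact ⟨T, lt_of_le_of_ne hT.2 (by rintro rfl; exact hright.ne' h), h⟩

/-- A neutral root of the cubic is a positive double root, so the cubic is nonnegative on the
positive half-line. -/
lemma fixedCubic_nonneg_of_neutral {L τ T₀ T : ℝ} (hL : 1 < L) (hτ : 0 < τ)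
    (h₀ : fixedCubic L τ T₀ = 0) (hn : (2 * L - 1) * T₀ ^ 2 + 2 * L - L ^ 2 = 0)
    (hT : 0 < T) : 0 ≤ fixedCubic L τ T := by
  have hT₀ : 0 < T₀ := by
    rcases lt_trichotomy T₀ 0 with h | h | h
    · exact absurd hn (multiplier_pos_of_fixedCubic_eq_zero hL hτ h h₀).ne'
    · subst h
      have : τ * L ^ 2 = 0 := by simpa [fixedCubic] using h₀
      exact absurd this (by positivity)
    · exact h
  have hA : 0 < L ^ 2 + (2 * L - 1) * T₀ ^ 2 := by
    have : 0 < 2 * L - 1 := by linarith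
    positivity
  have hderiv : 3 * T₀ ^ 2 + 2 * (2 * L - 1) * τ * T₀ + (2 * L - L ^ 2) = 0 := by
    refine (mul_eq_zero.1 (?_ : (L ^ 2 + (2 * L - 1) * T₀ ^ 2) * _ = 0)).resolve_left hA.ne'
    rw [fixedCubic] at h₀
    linear_combination 2 * (2 * L - 1) * T₀ * h₀ + (T₀ ^ 2 + L ^ 2) * hn
  have hfac : fixedCubic L τ T = (T - T₀) ^ 2 * (T + 2 * T₀ + (2 * L - 1) * τ) := by
    rw [fixedCubic] at h₀ ⊢
    linear_combination h₀ + (T - T₀) * hderiv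
  rw [hfac]
  have : 0 < 2 * L - 1 := by linarith
  positivity

lemma fixedCubic_neg_of_lt {K L τ T : ℝ} (hK : 1 < K) (hKL : K < L) (hT : 0 < T)
    (h : fixedCubic K τ T = 0) : fixedCubic L τ T < 0 := by
  have hA : 0 < K ^ 2 + (2 * K - 1) * T ^ 2 := by
    have : 0 < 2 * K - 1 := by linarith
    positivity
  have hid : (K ^ 2 + (2 * K - 1) * T ^ 2) * (-fixedCubic L τ T) =
      2 * T * (1 + T ^ 2) * (L - K) * (K * L + T ^ 2) := by
    rw [fixedCubic] at h ⊢
    linear_combination -(L ^ 2 + (2 * L - 1) * T ^ 2) * h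
  have hpos : 0 < 2 * T * (1 + T ^ 2) * (L - K) * (K * L + T ^ 2) := by
    have : 0 < L - K := by linarith
    have : 0 < K := by linarith
    have : 0 < L := by linarith
    positivity
  exact neg_pos.1 (pos_of_mul_pos_right (hid ▸ hpos) hA.le)

/-- for `1 < K < K_θ` there is exactly one fixed angle; it lies in
`(θ − π/2, 0)` and is repelling. -/
theorem one_fixed_angle_below_K_theta (θ Kθ K : ℝ) (hθ : θ ∈ Set.Ioo 0 (π / 2))
    (hKθ1 : 1 < Kθ)
    (hKθneut : ∃ φ : ℝ, φ ∈ Set.Ioc (-π) π ∧ IsFixedAngle Kθ θ φ ∧ IsNeutral Kθ θ φ)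
    (hKθuniq : ∀ K' : ℝ, 1 < K' →
      (∃ φ : ℝ, φ ∈ Set.Ioc (-π) π ∧ IsFixedAngle K' θ φ ∧ IsNeutral K' θ φ) → K' = Kθ)
    (hK1 : 1 < K) (hKlt : K < Kθ) :
    ∃ φ : ℝ, φ ∈ Set.Ioo (θ - π / 2) 0 ∧ IsFixedAngle K θ φ ∧ IsRepelling K θ φ ∧
      ∀ ψ : ℝ, ψ ∈ Set.Ioc (-π) π → IsFixedAngle K θ ψ → ψ = φ := by
  have hC : 0 < Real.cos θ := Real.cos_pos_of_mem_Ioo ⟨by linarith [hθ.1, Real.pi_pos], hθ.2⟩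
  have hτ : 0 < Real.tan θ := Real.tan_pos_of_pos_of_lt_pi_div_two hθ.1 hθ.2
  obtain ⟨φ₀, -, hfix, hneut⟩ := hKθneut
  obtain ⟨hc₀, hF₀⟩ := (isFixedAngle_iff_s13 hKθ1 hC).1 hfix
  have hn₀ := hneut.tan_eq hKθ1 hc₀
  obtain ⟨T, hTτ, hT⟩ := exists_fixedCubic_root_lt_neg hK1 hτ
  have hT0 : T < 0 := by linarith
  have hcos : 0 < Real.cos (θ + Real.arctan T - θ) := by
    rw [add_sub_cancel_left]; exact Real.cos_arctan_pos T
  have htan : Real.tan (θ + Real.arctan T - θ) = T := by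
    rw [add_sub_cancel_left, Real.tan_arctan]
  refine ⟨θ + Real.arctan T, ⟨by linarith [Real.neg_pi_div_two_lt_arctan T], ?_⟩,
    (isFixedAngle_iff_s13 hK1 hC).2 ⟨hcos, by rw [htan, hT]⟩, ?_, ?_⟩
  · have h := Real.arctan_strictMono hTτ
    rw [Real.arctan_neg, Real.arctan_tan (by linarith [hθ.1, Real.pi_pos]) hθ.2] at h
    linarith
  · apply isRepelling_of_tan hK1 hcos
    rw [htan]
    exact multiplier_pos_of_fixedCubic_eq_zero hK1 hτ hT0 hT
  · intro ψ hψ hψfix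
    obtain ⟨hc, hF⟩ := (isFixedAngle_iff_s13 hK1 hC).1 hψfix
    have hneg : Real.tan (ψ - θ) < 0 := by
      rcases lt_trichotomy (Real.tan (ψ - θ)) 0 with h | h | h
      · exact h
      · rw [h] at hF
        have : Real.tan θ * K ^ 2 = 0 := by simpa [fixedCubic] using hF
        exact absurd this (by positivity)
      · exact absurd (fixedCubic_neg_of_lt hK1 hKlt h hF)
          (fixedCubic_nonneg_of_neutral hKθ1 hτ hF₀ hn₀ h).not_gt
    have hψT := fixedCubic_neg_root_unique hK1 hτ hneg hT0 hF hT
    have hlo : -(π / 2) < ψ - θ := by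
      by_contra! hle
      have := Real.cos_nonpos_of_pi_div_two_le_of_le (x := -(ψ - θ)) (by linarith)
        (by linarith [hψ.1, hθ.2])
      rw [Real.cos_neg] at this
      linarith
    have hhi : ψ - θ < π / 2 := by
      by_contra! hle
      have := Real.cos_nonpos_of_pi_div_two_le_of_le hle (by linarith [hψ.2, hθ.1, Real.pi_pos])
      linarith
    rw [← hψT, Real.arctan_tan hlo hhi]
    ring
end

section
/- Let K > 1 and set α = (K−1)/(K+1). Then for every φ ∈ (−π, π), one has (e^{iφ} + α)/(1 + α·e^{iφ}) = exp(2i·arctan(tan(φ/2)/K)); that is, on the unit circle the Möbius transformation z ↦ (z+α)/(1+αz) agrees with the map induced on arguments by the affine stretch h_{K,0}, after the renormalization φ ↦ 2·arctan(tan(φ/2)/K). -/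
open Real Complex Filter Topology

theorem one_sub_ofReal_mul_I_ne_zero (t : ℝ) : 1 - (t : ℂ) * Complex.I ≠ 0 := fun h => by
  simpa using congrArg Complex.re h

theorem exp_two_mul_I_mul_arctan (t : ℝ) :
    Complex.exp (2 * Complex.I * (Real.arctan t : ℂ)) =
      (1 + (t : ℂ) * Complex.I) / (1 - (t : ℂ) * Complex.I) := by
  have hc : Complex.cos (Real.arctan t : ℂ) ≠ 0 := by
    exact_mod_cast (Real.cos_arctan_pos t).ne'
  have hs : Complex.sin (Real.arctan t : ℂ) = t * Complex.cos (Real.arctan t : ℂ) := by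
    rw [← div_eq_iff hc, ← Complex.tan_eq_sin_div_cos]
    exact_mod_cast Real.tan_arctan t
  have hcs := Complex.sin_sq_add_cos_sq (Real.arctan t : ℂ)
  rw [hs] at hcs
  have h2 : 2 * Complex.I * (Real.arctan t : ℂ) =
      Real.arctan t * Complex.I + Real.arctan t * Complex.I := by ring
  rw [eq_div_iff (one_sub_ofReal_mul_I_ne_zero t), h2, Complex.exp_add, Complex.exp_mul_I, hs]
  linear_combination (1 + (t : ℂ) * Complex.I) * hcs -
    (t * Complex.cos (Real.arctan t : ℂ)) ^ 2 * (1 + (t : ℂ) * Complex.I) * Complex.I_sq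

/-- on the unit circle, the Möbius map `z ↦ (z+α)/(1+αz)` with
`α = (K−1)/(K+1)` agrees with `φ ↦ 2 arctan(tan(φ/2)/K)`. -/
theorem moebius_agrees_with_induced_map (K : ℝ) (hK1 : 1 < K) (φ : ℝ)
    (hφ : φ ∈ Set.Ioo (-π) π) :
    (Complex.exp ((φ : ℂ) * Complex.I) + (((K - 1) / (K + 1) : ℝ) : ℂ)) /
      (1 + (((K - 1) / (K + 1) : ℝ) : ℂ) * Complex.exp ((φ : ℂ) * Complex.I)) =
    Complex.exp (2 * Complex.I * ((Real.arctan (Real.tan (φ / 2) / K) : ℝ) : ℂ)) := by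
  have hφ' : Complex.exp ((φ : ℂ) * Complex.I) =
      (1 + (Real.tan (φ / 2) : ℂ) * Complex.I) / (1 - (Real.tan (φ / 2) : ℂ) * Complex.I) := by
    rw [← exp_two_mul_I_mul_arctan,
      Real.arctan_tan (by linarith [hφ.1]) (by linarith [hφ.2])]
    congr 1
    push_cast
    ring
  rw [hφ', exp_two_mul_I_mul_arctan]
  generalize Real.tan (φ / 2) = t
  have ht := one_sub_ofReal_mul_I_ne_zero t
  have hK₀ : (K : ℂ) ≠ 0 := by exact_mod_cast (by linarith : K ≠ 0)
  have hK₁ : (K : ℂ) + 1 ≠ 0 := by exact_mod_cast (by linarith : K + 1 ≠ 0)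
  have hnum : (1 + (t : ℂ) * Complex.I) / (1 - t * Complex.I) + (((K - 1) / (K + 1) : ℝ) : ℂ) =
      2 * K / ((K + 1) * (1 - t * Complex.I)) * (1 + ((t / K : ℝ) : ℂ) * Complex.I) := by
    push_cast
    field_simp
    ring
  have hden : 1 + (((K - 1) / (K + 1) : ℝ) : ℂ) *
        ((1 + (t : ℂ) * Complex.I) / (1 - t * Complex.I)) =
      2 * K / ((K + 1) * (1 - t * Complex.I)) * (1 - ((t / K : ℝ) : ℂ) * Complex.I) := by
    push_cast
    field_simp
    ring
  rw [hnum, hden, mul_div_mul_left]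
  exact div_ne_zero (mul_ne_zero two_ne_zero hK₀) (mul_ne_zero hK₁ ht)
end
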